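/- arXiv:2108.02608 — 4 statements merged into one kernel-verified Lean document; each statement's English description precedes it below -/
import Mathlib

section
/- Let B be the quotient of the free associative algebra k⟨x1,y,x2,x3⟩ by the two-sided ideal generated by: y·x1 + x1·y; y²; s²; r²; r·x3 + q13²·x3·r; x3²; x13²; x1²; x2·x3 − q23·x3·x2; x1·x2 − q12·x2·x1; z100·x2 − q12·x2·z100; z010²; z001²; z101²; z011²; y·Y − q12²·q13²·Y·y + q12·q13·z001·z101; z110·Y − Y·z110 + z001·Y. Then the images in B of the monomials z000^{m000}·z100^{m100}·z010^{m010}·z001^{m001}·Y^{m}·z110^{m110}·z101^{m101}·z011^{m011}·z111^{m111}·y^{a1}·s^{a2}·r^{a3}·x3^{a4}·x13^{a5}·x1^{a6}, where a1,…,a6, m100, m010, m001, m101, m011 ∈ {0,1} and m000, m, m110, m111 ∈ ℕ, form a k-vector space basis of B. -/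
/- Statement 10: PBW basis of the Nichols algebra 𝔅(𝔈^{∞}(q†)) (Theorem 5.4 of the paper). -/

noncomputable section
namespace Stmt10

variable (k : Type*) [Field k] (q12 q13 q23 : k)

def x1 : FreeAlgebra k (Fin 4) := FreeAlgebra.ι k 0
/-- `y` stands for the generator x_{3/2} of the paper. -/
def y : FreeAlgebra k (Fin 4) := FreeAlgebra.ι k 1
def x2 : FreeAlgebra k (Fin 4) := FreeAlgebra.ι k 2
def x3 : FreeAlgebra k (Fin 4) := FreeAlgebra.ι k 3

/-- x13 := x1·x3 − q13·x3·x1 -/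
def x13 : FreeAlgebra k (Fin 4) := x1 k * x3 k - q13 • (x3 k * x1 k)
/-- s := x3·y + q13⁻¹·y·x3 (the element x_{3 3/2}) -/
def s : FreeAlgebra k (Fin 4) := x3 k * y k + q13⁻¹ • (y k * x3 k)
/-- r := x1·s + q13·s·x1 (the element x_{13 3/2}) -/
def r : FreeAlgebra k (Fin 4) := x1 k * s k q13 + q13 • (s k q13 * x1 k)

def z000 : FreeAlgebra k (Fin 4) := x2 k
def z100 : FreeAlgebra k (Fin 4) := y k * x2 k - q12 • (x2 k * y k)
def z010 : FreeAlgebra k (Fin 4) :=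
  x3 k * z100 k q12 + (q13⁻¹ * q23⁻¹) • (z100 k q12 * x3 k)
def z110 : FreeAlgebra k (Fin 4) :=
  y k * z010 k q12 q13 q23 + (q12 * q13) • (z010 k q12 q13 q23 * y k)
def z001 : FreeAlgebra k (Fin 4) :=
  x1 k * z010 k q12 q13 q23 + (q12 * q13) • (z010 k q12 q13 q23 * x1 k)
def z101 : FreeAlgebra k (Fin 4) :=
  y k * z001 k q12 q13 q23 - (q12 * q13) • (z001 k q12 q13 q23 * y k)
def z011 : FreeAlgebra k (Fin 4) :=
  x3 k * z101 k q12 q13 q23 - ((q13 ^ 3)⁻¹ * q23⁻¹) • (z101 k q12 q13 q23 * x3 k)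
def z111 : FreeAlgebra k (Fin 4) :=
  y k * z011 k q12 q13 q23 + (q12 * q13 ^ 2) • (z011 k q12 q13 q23 * y k)
/-- Y := z110·z001 + z001·z110 -/
def Y : FreeAlgebra k (Fin 4) :=
  z110 k q12 q13 q23 * z001 k q12 q13 q23 + z001 k q12 q13 q23 * z110 k q12 q13 q23

def rels : Set (FreeAlgebra k (Fin 4)) :=
  { y k * x1 k + x1 k * y k,
    y k ^ 2,
    s k q13 ^ 2,
    r k q13 ^ 2,
    r k q13 * x3 k + (q13 ^ 2) • (x3 k * r k q13),
    x3 k ^ 2,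
    x13 k q13 ^ 2,
    x1 k ^ 2,
    x2 k * x3 k - q23 • (x3 k * x2 k),
    x1 k * x2 k - q12 • (x2 k * x1 k),
    z100 k q12 * x2 k - q12 • (x2 k * z100 k q12),
    z010 k q12 q13 q23 ^ 2,
    z001 k q12 q13 q23 ^ 2,
    z101 k q12 q13 q23 ^ 2,
    z011 k q12 q13 q23 ^ 2,
    y k * Y k q12 q13 q23 - (q12 ^ 2 * q13 ^ 2) • (Y k q12 q13 q23 * y k)
      + (q12 * q13) • (z001 k q12 q13 q23 * z101 k q12 q13 q23),
    z110 k q12 q13 q23 * Y k q12 q13 q23 - Y k q12 q13 q23 * z110 k q12 q13 q23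
      + z001 k q12 q13 q23 * Y k q12 q13 q23 }

def rel (a b : FreeAlgebra k (Fin 4)) : Prop := a ∈ rels k q12 q13 q23 ∧ b = 0

/-- The index set of the PBW monomials. -/
structure Idx where
  m000 : ℕ
  m100 : Fin 2
  m010 : Fin 2
  m001 : Fin 2
  m : ℕ
  m110 : ℕ
  m101 : Fin 2
  m011 : Fin 2
  m111 : ℕ
  a1 : Fin 2
  a2 : Fin 2
  a3 : Fin 2
  a4 : Fin 2
  a5 : Fin 2
  a6 : Fin 2

/-- The PBW monomials
z000^{m000}·z100^{m100}·z010^{m010}·z001^{m001}·Y^m·z110^{m110}·z101^{m101}·z011^{m011}·z111^{m111}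
·y^{a1}·s^{a2}·r^{a3}·x3^{a4}·x13^{a5}·x1^{a6}. -/
def mon (i : Idx) : RingQuot (rel k q12 q13 q23) :=
  RingQuot.mkAlgHom k (rel k q12 q13 q23)
    (z000 k ^ i.m000 * z100 k q12 ^ (i.m100 : ℕ) * z010 k q12 q13 q23 ^ (i.m010 : ℕ) *
      z001 k q12 q13 q23 ^ (i.m001 : ℕ) * Y k q12 q13 q23 ^ i.m *
      z110 k q12 q13 q23 ^ i.m110 * z101 k q12 q13 q23 ^ (i.m101 : ℕ) *
      z011 k q12 q13 q23 ^ (i.m011 : ℕ) * z111 k q12 q13 q23 ^ i.m111 *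
      y k ^ (i.a1 : ℕ) * s k q13 ^ (i.a2 : ℕ) * r k q13 ^ (i.a3 : ℕ) *
      x3 k ^ (i.a4 : ℕ) * x13 k q13 ^ (i.a5 : ℕ) * x1 k ^ (i.a6 : ℕ))

/-! ### Noncommutative polynomials with Laurent monomial coefficients -/

/-- Words in the letters `x1, x3, y, z111, z011, z101, z110, z001, z010, z100, z000`,
numbered in this order. -/
abbrev Word := List (Fin 11)

/-- `(n, e₁, e₂, e₃)` stands for `n * q12 ^ e₁ * q13 ^ e₂ * q23 ^ e₃`. -/
abbrev Coef := ℤ × ℤ × ℤ × ℤ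

/-- A linear combination of words, as a list of terms. -/
abbrev Poly := List (Coef × Word)

/-- A rewriting rule, replacing its leading word by its tail. -/
abbrev Rule := Word × Poly

def mulCoef (c d : Coef) : Coef :=
  (c.1 * d.1, c.2.1 + d.2.1, c.2.2.1 + d.2.2.1, c.2.2.2 + d.2.2.2)

def smulPoly (c : Coef) (p : Poly) : Poly := p.map fun t => (mulCoef c t.1, t.2)

def mulPoly (p p' : Poly) : Poly :=
  p.flatMap fun t => p'.map fun t' => (mulCoef t.1 t'.1, t.2 ++ t'.2)

/-- The polynomial `a * p * b`, for words `a` and `b`. -/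
def wrapPoly (a b : Word) (p : Poly) : Poly := p.map fun t => (t.1, a ++ t.2 ++ b)

/-- Add a term to a polynomial, collecting it with a term with the same word and exponents. -/
def addTerm (t : Coef × Word) : Poly → Poly
  | [] => [t]
  | u :: p => if u.2 = t.2 ∧ u.1.2 = t.1.2 then ((t.1.1 + u.1.1, u.1.2), u.2) :: p
      else u :: addTerm t p

/-- The first rule whose leading word is a prefix of `w`, with the remaining suffix of `w`. -/
def matchPrefix (w : Word) : List Rule → Option (Rule × Word)
  | [] => none
  | r :: R => if r.1.isPrefixOf w then some (r, w.drop r.1.length) else matchPrefix w R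

/-- The rules whose leading word starts with `c`. -/
def bucket (R : List Rule) (c : Fin 11) : List Rule := R.filter fun r => r.1.head? == some c

/-- The leftmost occurrence of the leading word of a rule in a word. -/
def findRule (R : List Rule) : Word → Option (Word × Rule × Word)
  | [] => none
  | c :: w => match matchPrefix (c :: w) (bucket R c) with
    | some x => some ([], x.1, x.2)
    | none => (findRule R w).map fun x => (c :: x.1, x.2.1, x.2.2)

/-- Rewrite the terms of `todo`, collecting the irreducible ones in `done`. -/
def reduce (R : List Rule) : ℕ → Poly → Poly → Poly
  | 0, todo, done => todo ++ done
  | _ + 1, [], done => done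
  | n + 1, t :: todo, done => match findRule R t.2 with
    | none => reduce R n todo (addTerm t done)
    | some (a, r, b) => reduce R n (smulPoly t.1 (wrapPoly a b r.2) ++ todo) done

def reducesToZero (R : List Rule) (n : ℕ) (p : Poly) : Bool :=
  (reduce R n p []).all fun t => t.1.1 == 0

/-- The S-polynomial of two rules whose leading words overlap, the second one starting at
position `d` of the first one. -/
def sPolynomial (r r' : Rule) (d : ℕ) : Poly :=
  wrapPoly [] (r'.1.drop (r.1.length - d)) r.2 ++
    smulPoly (-1, 0, 0, 0) (wrapPoly (r.1.take d) [] r'.2)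

/-- All overlaps of leading words resolve. -/
def overlapsResolve (R : List Rule) (n : ℕ) : Bool :=
  R.all fun r => R.all fun r' => (List.range r.1.length).all fun d =>
    if (r.1.drop d).isPrefixOf r'.1 then reducesToZero R n (sPolynomial r r' d)
    else !r'.1.isPrefixOf (r.1.drop d)

/-- How a rule is obtained: from the polynomial with the given index in a list of initial
polynomials, or from the overlap of two previous rules. -/
inductive Source
  | base (i : ℕ)
  | overlap (i j d : ℕ)

def Source.poly (base : List Poly) (R : List Rule) : Source → Poly
  | .base i => (base[i]?).getD []
  | .overlap i j d => match R[i]?, R[j]? with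
    | some r, some r' =>
      if (r.1.drop d).isPrefixOf r'.1 then sPolynomial r r' d else []
    | _, _ => []

/-- `c * (r.1 - r.2)` -/
def Rule.toPoly (r : Rule) (c : Coef) : Poly :=
  (c, r.1) :: smulPoly (mulCoef (-1, 0, 0, 0) c) r.2

/-- Each of the given rules is a consequence of the initial polynomials and the previous rules. -/
def derivable (base : List Poly) (n : ℕ) : List Rule → List (Rule × Source × Coef) → Bool
  | _, [] => true
  | R, d :: D => d.2.2.1 != 0 &&
      reducesToZero R n (d.2.1.poly base R ++ Rule.toPoly d.1 (mulCoef (-1, 0, 0, 0) d.2.2)) &&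
      derivable base n (R ++ [d.1]) D

/-! ### The rewriting system -/

def letter (c : Fin 11) : Poly := [((1, 0, 0, 0), [c])]

def sPoly : Poly :=
  mulPoly (letter 1) (letter 2) ++ smulPoly (1, 0, -1, 0) (mulPoly (letter 2) (letter 1))

def rPoly : Poly :=
  mulPoly (letter 0) sPoly ++ smulPoly (1, 0, 1, 0) (mulPoly sPoly (letter 0))

def x13Poly : Poly :=
  mulPoly (letter 0) (letter 1) ++ smulPoly (-1, 0, 1, 0) (mulPoly (letter 1) (letter 0))

def YPoly : Poly := mulPoly (letter 6) (letter 7) ++ mulPoly (letter 7) (letter 6)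

/-- The polynomial `p * p' + c * p' * p`. -/
def commPoly (c : Coef) (p p' : Poly) : Poly := mulPoly p p' ++ smulPoly c (mulPoly p' p)

/-- The defining relations. -/
def relPolys : List Poly :=
  [commPoly (1, 0, 0, 0) (letter 2) (letter 0),
    mulPoly (letter 2) (letter 2),
    mulPoly sPoly sPoly,
    mulPoly rPoly rPoly,
    commPoly (1, 0, 2, 0) rPoly (letter 1),
    mulPoly (letter 1) (letter 1),
    mulPoly x13Poly x13Poly,
    mulPoly (letter 0) (letter 0),
    commPoly (-1, 0, 0, 1) (letter 10) (letter 1),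
    commPoly (-1, 1, 0, 0) (letter 0) (letter 10),
    commPoly (-1, 1, 0, 0) (letter 9) (letter 10),
    mulPoly (letter 8) (letter 8),
    mulPoly (letter 7) (letter 7),
    mulPoly (letter 5) (letter 5),
    mulPoly (letter 4) (letter 4),
    commPoly (-1, 2, 2, 0) (letter 2) YPoly ++
      smulPoly (1, 1, 1, 0) (mulPoly (letter 7) (letter 5)),
    commPoly (-1, 0, 0, 0) (letter 6) YPoly ++ mulPoly (letter 7) YPoly]

/-- The definitions of the letters `z100, …, z111`. -/
def defPolys : List Poly :=
  [commPoly (-1, 1, 0, 0) (letter 2) (letter 10) ++ smulPoly (-1, 0, 0, 0) (letter 9),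
    commPoly (1, 0, -1, -1) (letter 1) (letter 9) ++ smulPoly (-1, 0, 0, 0) (letter 8),
    commPoly (1, 1, 1, 0) (letter 2) (letter 8) ++ smulPoly (-1, 0, 0, 0) (letter 6),
    commPoly (1, 1, 1, 0) (letter 0) (letter 8) ++ smulPoly (-1, 0, 0, 0) (letter 7),
    commPoly (-1, 1, 1, 0) (letter 2) (letter 7) ++ smulPoly (-1, 0, 0, 0) (letter 5),
    commPoly (-1, 0, -3, -1) (letter 1) (letter 5) ++ smulPoly (-1, 0, 0, 0) (letter 4),
    commPoly (1, 1, 2, 0) (letter 2) (letter 4) ++ smulPoly (-1, 0, 0, 0) (letter 3)]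

/-- The rewriting rules, each with a derivation from `relPolys` and `defPolys`. -/
def ruleData : List (Rule × Source × Coef) := [
  (([0, 2], [((-1, 0, 0, 0), [2, 0])]),
    .base 0, (1, 0, 0, 0)),
  (([2, 2], []),
    .base 1, (1, 0, 0, 0)),
  (([1, 1], []),
    .base 5, (1, 0, 0, 0)),
  (([1, 2, 1, 2], [((-1, 0, -2, 0), [2, 1, 2, 1])]),
    .base 2, (1, 0, 0, 0)),
  (([1, 0, 1, 2], [((-1, 0, -2, 0), [0, 1, 2, 1]), ((-1, 0, -2, 0), [2, 1, 0, 1]), ((-1, 0, 0, 0), [1, 2, 1, 0])]),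
    .base 4, (1, 0, 2, 0)),
  (([0, 0], []),
    .base 7, (1, 0, 0, 0)),
  (([0, 1, 2, 0, 1, 2], [((-1, 0, -2, 0), [2, 0, 1, 2, 0, 1]), ((-1, 0, 2, 0), [1, 2, 0, 1, 2, 0]), ((1, 0, 0, 0), [2, 1, 2, 0, 1, 0])]),
    .base 3, (1, 0, 0, 0)),
  (([0, 1, 0, 1], [((-1, 0, 2, 0), [1, 0, 1, 0])]),
    .base 6, (1, 0, 0, 0)),
  (([1, 10], [((1, 0, 0, -1), [10, 1])]),
    .base 8, (-1, 0, 0, 1)),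
  (([0, 10], [((1, 1, 0, 0), [10, 0])]),
    .base 9, (1, 0, 0, 0)),
  (([9, 10], [((1, 1, 0, 0), [10, 9])]),
    .base 10, (1, 0, 0, 0)),
  (([8, 8], []),
    .base 11, (1, 0, 0, 0)),
  (([7, 7], []),
    .base 12, (1, 0, 0, 0)),
  (([5, 5], []),
    .base 13, (1, 0, 0, 0)),
  (([4, 4], []),
    .base 14, (1, 0, 0, 0)),
  (([6, 6, 7], [((1, 0, 0, 0), [7, 6, 6]), ((-1, 0, 0, 0), [7, 6, 7])]),
    .base 16, (1, 0, 0, 0)),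
  (([2, 10], [((1, 0, 0, 0), [9]), ((1, 1, 0, 0), [10, 2])]),
    .base 17, (1, 0, 0, 0)),
  (([1, 9], [((1, 0, 0, 0), [8]), ((-1, 0, -1, -1), [9, 1])]),
    .base 18, (1, 0, 0, 0)),
  (([2, 8], [((1, 0, 0, 0), [6]), ((-1, 1, 1, 0), [8, 2])]),
    .base 19, (1, 0, 0, 0)),
  (([0, 8], [((1, 0, 0, 0), [7]), ((-1, 1, 1, 0), [8, 0])]),
    .base 20, (1, 0, 0, 0)),
  (([2, 7], [((1, 0, 0, 0), [5]), ((1, 1, 1, 0), [7, 2])]),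
    .base 21, (1, 0, 0, 0)),
  (([1, 5], [((1, 0, 0, 0), [4]), ((1, 0, -3, -1), [5, 1])]),
    .base 22, (1, 0, 0, 0)),
  (([2, 4], [((1, 0, 0, 0), [3]), ((-1, 1, 2, 0), [4, 2])]),
    .base 23, (1, 0, 0, 0)),
  (([0, 9], [((-1, 1, 0, 0), [9, 0])]),
    .overlap 0 16 1, (-1, 0, 0, 0)),
  (([0, 6], [((-1, 0, 0, 0), [5]), ((1, 1, 1, 0), [6, 0])]),
    .overlap 0 18 1, (-1, 0, 0, 0)),
  (([2, 9], [((-1, 1, 0, 0), [9, 2])]),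
    .overlap 1 16 1, (-1, 0, 0, 0)),
  (([2, 6], [((1, 1, 1, 0), [6, 2])]),
    .overlap 1 18 1, (-1, 0, 0, 0)),
  (([5, 6], [((-1, 1, 1, 0), [6, 5]), ((-1, 1, 1, 0), [7, 5])]),
    .base 15, (1, 0, 0, 0)),
  (([2, 5], [((-1, 1, 1, 0), [5, 2])]),
    .overlap 0 26 1, (1, 0, 0, 0)),
  (([2, 3], [((1, 1, 2, 0), [3, 2])]),
    .overlap 1 22 1, (-1, 0, 0, 0)),
  (([1, 8], [((1, 0, -1, -1), [8, 1])]),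
    .overlap 2 17 1, (-1, 0, 0, 0)),
  (([1, 4], [((-1, 0, -3, -1), [4, 1])]),
    .overlap 2 21 1, (-1, 0, 0, 0)),
  (([1, 6], [((-1, 0, -2, -1), [6, 1])]),
    .overlap 3 16 3, (-1, 0, 0, 0)),
  (([1, 7], [((-1, 0, -2, -1), [7, 1])]),
    .overlap 4 16 3, (-1, 0, 0, 0)),
  (([1, 3], [((1, 0, -4, -1), [3, 1])]),
    .overlap 3 20 3, (-1, 0, 0, 0)),
  (([0, 7], [((1, 1, 1, 0), [7, 0])]),
    .overlap 5 19 1, (-1, 0, 0, 0)),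
  (([0, 5], [((-1, 1, 1, 0), [5, 0])]),
    .overlap 0 20 1, (-1, 0, 0, 0)),
  (([0, 4], [((-1, 1, 2, 0), [4, 0])]),
    .overlap 6 16 5, (-1, 0, 0, 0)),
  (([0, 3], [((1, 1, 2, 0), [3, 0])]),
    .overlap 0 22 1, (-1, 0, 0, 0)),
  (([8, 10], [((1, 1, 0, -1), [10, 8])]),
    .overlap 17 10 1, (1, 0, 0, 0)),
  (([6, 8], [((1, 1, 1, 0), [8, 6])]),
    .overlap 18 11 1, (1, 0, 0, 0)),
  (([7, 8], [((1, 1, 1, 0), [8, 7])]),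
    .overlap 19 11 1, (1, 0, 0, 0)),
  (([7, 10], [((1, 2, 0, -1), [10, 7])]),
    .overlap 19 39 1, (1, 0, 0, 0)),
  (([5, 7], [((-1, 1, 1, 0), [7, 5])]),
    .overlap 20 12 1, (1, 0, 0, 0)),
  (([5, 8], [((1, 1, 1, 0), [6, 7]), ((-1, 1, 1, 0), [7, 6]), ((-1, 2, 2, 0), [8, 5])]),
    .overlap 20 41 1, (1, 0, 0, 0)),
  (([4, 5], [((-1, 0, -3, -1), [5, 4])]),
    .overlap 21 13 1, (1, 0, 0, 0)),
  (([4, 6], [((1, 1, -1, -1), [6, 4]), ((1, 1, -1, -1), [7, 4])]),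
    .overlap 21 27 1, (1, 0, 0, 0)),
  (([4, 7], [((1, 1, -1, -1), [7, 4])]),
    .overlap 21 43 1, (1, 0, 0, 0)),
  (([4, 8], [((-1, 2, 1, -1), [8, 4])]),
    .overlap 21 44 1, (1, 0, 0, 0)),
  (([3, 4], [((1, 1, 2, 0), [4, 3])]),
    .overlap 22 14 1, (1, 0, 0, 0)),
  (([3, 5], [((1, 1, -2, -1), [5, 3])]),
    .overlap 22 45 1, (1, 0, 0, 0)),
  (([3, 6], [((1, 2, 0, -1), [6, 3]), ((1, 1, -1, -1), [5, 4]), ((1, 2, 0, -1), [7, 3])]),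
    .overlap 22 46 1, (1, 0, 0, 0)),
  (([3, 7], [((1, 2, 0, -1), [7, 3])]),
    .overlap 22 47 1, (1, 0, 0, 0)),
  (([3, 8], [((1, 3, 2, -1), [8, 3]), ((1, 2, 1, -1), [7, 4])]),
    .overlap 22 48 1, (1, 0, 0, 0)),
  (([9, 9], []),
    .overlap 25 10 1, (-2, 1, 0, 0)),
  (([8, 9], [((1, 0, -1, -1), [9, 8])]),
    .overlap 17 54 1, (1, 0, 0, 0)),
  (([6, 10], [((2, 1, 0, -1), [9, 8]), ((1, 2, 0, -1), [10, 6])]),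
    .overlap 18 39 1, (1, 0, 0, 0)),
  (([6, 9], [((-1, 1, -1, -1), [9, 6])]),
    .overlap 18 55 1, (1, 0, 0, 0)),
  (([7, 9], [((-1, 1, -1, -1), [9, 7])]),
    .overlap 19 55 1, (1, 0, 0, 0)),
  (([5, 10], [((2, 2, 0, -1), [9, 7]), ((1, 3, 0, -1), [10, 5])]),
    .overlap 20 42 1, (1, 0, 0, 0)),
  (([5, 9], [((1, 2, -1, -1), [9, 5])]),
    .overlap 20 58 1, (1, 0, 0, 0)),
  (([4, 10], [((2, 2, 0, -1), [8, 7]), ((1, 3, 0, -2), [10, 4])]),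
    .overlap 21 59 1, (1, 0, 0, 0)),
  (([4, 9], [((-1, 1, -2, -1), [6, 7]), ((1, 1, -2, -1), [7, 6]), ((2, 2, -1, -1), [8, 5]), ((-1, 2, -2, -2), [9, 4])]),
    .overlap 21 60 1, (1, 0, 0, 0)),
  (([3, 10], [((1, 2, 0, -1), [6, 7]), ((1, 2, 0, -1), [7, 6]), ((1, 4, 0, -2), [10, 3])]),
    .overlap 22 61 1, (1, 0, 0, 0)),
  (([3, 9], [((1, 3, -2, -2), [9, 3]), ((-1, 2, -1, -1), [7, 5])]),
    .overlap 22 62 1, (1, 0, 0, 0))]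

def rules : List Rule := ruleData.map Prod.fst

set_option maxRecDepth 100000 in
theorem rules_derivable : derivable (relPolys ++ defPolys) 1000 [] ruleData = true := by
  decide +kernel

set_option maxRecDepth 100000 in
theorem rules_overlapsResolve : overlapsResolve rules 1000 = true := by decide +kernel

set_option maxRecDepth 100000 in
theorem relPolys_reduce : (relPolys.all fun p => reducesToZero rules 1000 p) = true := by
  decide +kernel

set_option maxRecDepth 100000 in
theorem defPolys_reduce : (defPolys.all fun p => reducesToZero rules 1000 p) = true := by
  decide +kernel

/-! ### Evaluation of polynomials -/

/-- An evaluation of coefficients in a field. -/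
structure CoefVal (K : Type*) [Field K] where
  val : Coef → K
  val_one : val (1, 0, 0, 0) = 1
  val_mul (c d : Coef) : val (mulCoef c d) = val c * val d
  val_add (m n : ℤ) (e : ℤ × ℤ × ℤ) : val (m + n, e) = val (m, e) + val (n, e)
  val_ne_zero (c : Coef) : c.1 ≠ 0 → val c ≠ 0

section Eval

variable {K V V' : Type*} [Field K] [AddCommGroup V] [Module K V] [AddCommGroup V'] [Module K V']
  (φ : CoefVal K)

theorem CoefVal.val_zero (e : ℤ × ℤ × ℤ) : φ.val (0, e) = 0 := by
  simpa using φ.val_add 0 0 e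

theorem CoefVal.val_neg_one : φ.val (-1, 0, 0, 0) = -1 := by
  have h := φ.val_add (-1) 1 (0, 0, 0)
  rw [φ.val_one, show ((-1 : ℤ) + 1) = 0 from rfl, φ.val_zero] at h
  exact eq_neg_of_add_eq_zero_left h.symm

/-- The value of a polynomial, given the values of the words. -/
def eval (F : Word → V) (p : Poly) : V := (p.map fun t => φ.val t.1 • F t.2).sum

@[simp] theorem eval_nil (F : Word → V) : eval φ F [] = 0 := rfl

@[simp] theorem eval_cons (F : Word → V) (t : Coef × Word) (p : Poly) :
    eval φ F (t :: p) = φ.val t.1 • F t.2 + eval φ F p := by simp [eval]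

@[simp] theorem eval_append (F : Word → V) (p p' : Poly) :
    eval φ F (p ++ p') = eval φ F p + eval φ F p' := by simp [eval]

@[simp] theorem eval_smulPoly (F : Word → V) (c : Coef) (p : Poly) :
    eval φ F (smulPoly c p) = φ.val c • eval φ F p := by
  induction p with
  | nil => simp [smulPoly]
  | cons t p ih =>
    rw [smulPoly] at ih ⊢
    simp [ih, φ.val_mul, mul_smul]

@[simp] theorem eval_wrapPoly (F : Word → V) (a b : Word) (p : Poly) :
    eval φ F (wrapPoly a b p) = eval φ (fun t => F (a ++ t ++ b)) p := by
  simp [eval, wrapPoly, Function.comp_def]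

theorem eval_addTerm (F : Word → V) (t : Coef × Word) (p : Poly) :
    eval φ F (addTerm t p) = φ.val t.1 • F t.2 + eval φ F p := by
  induction p with
  | nil => simp [addTerm]
  | cons u p ih =>
    rw [addTerm]
    split_ifs with h
    · obtain ⟨⟨n, e⟩, w⟩ := t
      obtain ⟨⟨n', e'⟩, w'⟩ := u
      simp only at h
      obtain ⟨rfl, rfl⟩ := h
      simp [φ.val_add, add_smul, add_assoc]
    · simp [ih]; abel

theorem map_eval {L : Type*} [FunLike L V V'] [LinearMapClass L K V V'] (f : L)
    (F : Word → V) (p : Poly) : f (eval φ F p) = eval φ (fun w => f (F w)) p := by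
  induction p with
  | nil => simp
  | cons t p ih => simp [ih]

theorem eval_congr {F G : Word → V} {p : Poly} (h : ∀ t ∈ p, F t.2 = G t.2) :
    eval φ F p = eval φ G p := by
  unfold eval
  congr 1
  exact List.map_congr_left fun t ht => by rw [h t ht]

theorem eval_smul_add (c : K) (F G : Word → V) (p : Poly) :
    eval φ (fun w => c • F w + G w) p = c • eval φ F p + eval φ G p := by
  induction p with
  | nil => simp
  | cons t p ih =>
    simp only [eval_cons, ih, smul_add, smul_smul, mul_comm c]
    abel

theorem eval_comm (F : Word → Word → V) (p p' : Poly) :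
    eval φ (fun v => eval φ (F v) p') p = eval φ (fun w => eval φ (fun v => F v w) p) p' := by
  induction p with
  | nil =>
    induction p' with
    | nil => rfl
    | cons t p' ih => simpa using ih
  | cons t p ih => simp only [eval_cons, ih, eval_smul_add]

theorem eval_toPoly (F : Word → V) (r : Rule) (c : Coef) :
    eval φ F (Rule.toPoly r c) = φ.val c • (F r.1 - eval φ F r.2) := by
  simp [Rule.toPoly, φ.val_mul, φ.val_neg_one, sub_eq_add_neg]

theorem eval_mem {S : Submodule K V} {F : Word → V} {p : Poly} (h : ∀ t ∈ p, F t.2 ∈ S) :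
    eval φ F p ∈ S := by
  induction p with
  | nil => simp
  | cons t p ih =>
    rw [eval_cons]
    exact S.add_mem (S.smul_mem _ (h t (by simp))) (ih fun u hu => h u (by simp [hu]))

/-! ### Soundness of reduction -/

theorem matchPrefix_eq_some {w : Word} {R : List Rule} {r : Rule} {b : Word}
    (h : matchPrefix w R = some (r, b)) : r ∈ R ∧ w = r.1 ++ b := by
  induction R with
  | nil => simp [matchPrefix] at h
  | cons r' R ih =>
    rw [matchPrefix] at h
    split_ifs at h with hp
    · obtain ⟨rfl, rfl⟩ : r' = r ∧ _ = b := by simpa using h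
      refine ⟨by simp, ?_⟩
      obtain ⟨t, ht⟩ := List.isPrefixOf_iff_prefix.1 hp
      simp [← ht]
    · exact ⟨List.mem_cons_of_mem _ (ih h).1, (ih h).2⟩

theorem findRule_eq_some {R : List Rule} {w a b : Word} {r : Rule}
    (h : findRule R w = some (a, r, b)) : r ∈ R ∧ w = a ++ r.1 ++ b := by
  induction w generalizing a with
  | nil => simp [findRule] at h
  | cons c w ih =>
    rw [findRule] at h
    split at h
    · rename_i x hx
      obtain ⟨rfl, rfl⟩ : a = [] ∧ x = (r, b) := by simpa using h
      obtain ⟨h₁, h₂⟩ := matchPrefix_eq_some hx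
      exact ⟨List.mem_of_mem_filter h₁, by simpa using h₂⟩
    · obtain ⟨⟨a', r', b'⟩, hx, hx'⟩ := Option.map_eq_some_iff.1 h
      obtain ⟨rfl, rfl, rfl⟩ : c :: a' = a ∧ r' = r ∧ b' = b := by simpa using hx'
      obtain ⟨h₁, h₂⟩ := ih hx
      exact ⟨h₁, by simp [h₂]⟩

/-- `F` is compatible with the rules in `R`, on the words satisfying `P`. -/
def Respects (R : List Rule) (P : Word → Prop) (F : Word → V) : Prop :=
  ∀ r ∈ R, ∀ a b, P (a ++ r.1 ++ b) →
    F (a ++ r.1 ++ b) = eval φ (fun t => F (a ++ t ++ b)) r.2 ∧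
      ∀ t ∈ r.2, P (a ++ t.2 ++ b)

variable {φ}

theorem Respects.eval_reduce {R : List Rule} {P : Word → Prop} {F : Word → V}
    (h : Respects φ R P F) (n : ℕ) (todo done : Poly) (hP : ∀ t ∈ todo, P t.2) :
    eval φ F (reduce R n todo done) = eval φ F todo + eval φ F done := by
  induction n generalizing todo done with
  | zero => simp [reduce]
  | succ n ih =>
    cases todo with
    | nil => simp [reduce]
    | cons t todo =>
      have ht : P t.2 := hP t (by simp)
      have htodo : ∀ t ∈ todo, P t.2 := fun u hu => hP u (by simp [hu])
      rw [reduce]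
      split
      · rw [ih _ _ htodo, eval_addTerm, eval_cons]
        abel
      · rename_i a r b hx
        obtain ⟨hr, hw⟩ := findRule_eq_some hx
        rw [hw] at ht
        obtain ⟨h₁, h₂⟩ := h r hr a b ht
        rw [ih, eval_append, eval_smulPoly, eval_wrapPoly, ← h₁, ← hw, eval_cons]
        intro u hu
        rcases List.mem_append.1 hu with hu | hu
        · simp only [smulPoly, wrapPoly, List.map_map, List.mem_map, Function.comp] at hu
          obtain ⟨v, hv, rfl⟩ := hu
          exact h₂ v hv
        · exact htodo u hu

theorem Respects.eval_eq_zero {R : List Rule} {P : Word → Prop} {F : Word → V}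
    (h : Respects φ R P F) {n : ℕ} {p : Poly} (hP : ∀ t ∈ p, P t.2)
    (hp : reducesToZero R n p = true) : eval φ F p = 0 := by
  have h₁ := h.eval_reduce n p [] hP
  rw [eval_nil, add_zero] at h₁
  rw [← h₁]
  rw [reducesToZero, List.all_eq_true] at hp
  refine List.sum_eq_zero fun x hx => ?_
  obtain ⟨⟨⟨m, e⟩, w⟩, ht, rfl⟩ := List.mem_map.1 hx
  have := hp _ ht
  obtain rfl : m = 0 := by simpa using this
  simp [φ.val_zero]

end Eval

/-! ### The monomial order -/

/-- The number of factors `y` in the definition of a letter. -/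
def weight : Fin 11 → ℕ := ![0, 0, 1, 3, 2, 2, 2, 1, 1, 1, 0]

/-- Words are compared by length, then by total weight, then lexicographically from the right. -/
def key (w : Word) : ℕ ×ₗ ℕ ×ₗ ℕ :=
  toLex (w.length, toLex ((w.map weight).sum, Nat.ofDigits 11 (w.map Fin.val)))

/-- `Prec v w` means that `v` is smaller than `w` in the monomial order. -/
def Prec (v w : Word) : Prop := key v < key w

infix:50 "≺" => Prec

theorem prec_iff {v w : Word} : v ≺ w ↔ v.length < w.length ∨ v.length = w.length ∧
    ((v.map weight).sum < (w.map weight).sum ∨ (v.map weight).sum = (w.map weight).sum ∧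
      Nat.ofDigits 11 (v.map Fin.val) < Nat.ofDigits 11 (w.map Fin.val)) := by
  simp only [Prec, key, Prod.Lex.toLex_lt_toLex]

instance : DecidableRel Prec := fun _ _ => decidable_of_iff' _ prec_iff

theorem prec_wf : WellFounded Prec := InvImage.wf key wellFounded_lt

theorem Prec.trans {u v w : Word} (h : u ≺ v) (h' : v ≺ w) : u ≺ w :=
  lt_trans (α := ℕ ×ₗ ℕ ×ₗ ℕ) h h'

theorem Prec.irrefl (w : Word) : ¬ w ≺ w := lt_irrefl (key w)

theorem Prec.append {v w : Word} (h : v ≺ w) (a b : Word) : a ++ v ++ b ≺ a ++ w ++ b := by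
  rw [prec_iff] at h ⊢
  simp only [List.length_append, List.map_append, List.sum_append, Nat.ofDigits_append,
    List.length_map]
  rcases h with h | ⟨hl, h | ⟨hn, h⟩⟩
  · omega
  · omega
  · refine Or.inr ⟨by omega, Or.inr ⟨by omega, ?_⟩⟩
    rw [hl]
    have : 11 ^ a.length * Nat.ofDigits 11 (v.map Fin.val) <
        11 ^ a.length * Nat.ofDigits 11 (w.map Fin.val) :=
      Nat.mul_lt_mul_of_pos_left h (by positivity)
    omega

/-! ### Reducible words and normal forms -/

/-- A word is reducible if it contains the leading word of a rule. -/
def Reducible (R : List Rule) (w : Word) : Prop := ∃ r ∈ R, r.1 <:+: w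

theorem Reducible.cons {R : List Rule} {w : Word} (h : Reducible R w) (c : Fin 11) :
    Reducible R (c :: w) :=
  let ⟨r, hr, hw⟩ := h
  ⟨r, hr, hw.trans (List.suffix_cons c w).isInfix⟩

section NormalForm

variable {K : Type*} [Field K] (φ : CoefVal K) (R : List Rule)

open Classical in
/-- The normal form of a word, obtained by rewriting it with the rules in `R`. -/
def nf : Word → (Word →₀ K) :=
  prec_wf.fix fun w ih =>
    if h : ∃ x : Word × Rule × Word, x.2.1 ∈ R ∧ w = x.1 ++ x.2.1.1 ++ x.2.2 then
      eval φ (fun t => if ht : h.choose.1 ++ t ++ h.choose.2.2 ≺ w then ih _ ht else 0)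
        h.choose.2.1.2
    else Finsupp.single w 1

variable {R}

theorem nf_of_not_reducible {w : Word} (hw : ¬ Reducible R w) :
    nf φ R w = Finsupp.single w 1 := by
  rw [nf, prec_wf.fix_eq, dif_neg]
  rintro ⟨⟨a, r, b⟩, hr, rfl⟩
  exact hw ⟨r, hr, a, b, rfl⟩

theorem exists_nf_eq (hlt : ∀ r ∈ R, ∀ t ∈ r.2, t.2 ≺ r.1) {w : Word} (hw : Reducible R w) :
    ∃ a b, ∃ r ∈ R, w = a ++ r.1 ++ b ∧ nf φ R w = eval φ (fun t => nf φ R (a ++ t ++ b)) r.2 := by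
  have h : ∃ x : Word × Rule × Word, x.2.1 ∈ R ∧ w = x.1 ++ x.2.1.1 ++ x.2.2 := by
    obtain ⟨r, hr, a, b, rfl⟩ := hw
    exact ⟨⟨a, r, b⟩, hr, rfl⟩
  obtain ⟨h₁, h₂⟩ := h.choose_spec
  refine ⟨h.choose.1, h.choose.2.2, h.choose.2.1, h₁, h₂, ?_⟩
  conv_lhs => rw [nf, prec_wf.fix_eq, dif_pos h]
  refine eval_congr φ fun t ht => ?_
  rw [dif_pos]
  · rfl
  · conv_rhs => rw [h₂]
    exact (hlt _ h₁ t ht).append _ _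

/-- Normal forms are supported on words which are not larger. -/
theorem nf_mem_supported (hlt : ∀ r ∈ R, ∀ t ∈ r.2, t.2 ≺ r.1) (w : Word) :
    nf φ R w ∈ Finsupp.supported K K {v | v = w ∨ v ≺ w} := by
  induction w using prec_wf.induction with
  | _ w ih =>
    by_cases hw : Reducible R w
    · obtain ⟨a, b, r, hr, rfl, h⟩ := exists_nf_eq φ hlt hw
      rw [h]
      refine eval_mem φ fun t ht => ?_
      have hlt' := (hlt r hr t ht).append a b
      refine Finsupp.supported_mono ?_ (ih _ hlt')
      rintro v (rfl | hv)
      · exact Or.inr hlt'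
      · exact Or.inr (hv.trans hlt')
    · rw [nf_of_not_reducible φ hw]
      exact Finsupp.single_mem_supported K 1 (Or.inl rfl)

/-- Bergman's diamond lemma: if all overlaps resolve, then the normal form does not depend on the
choice of the rewriting steps. -/
theorem nf_eq_eval (hlt : ∀ r ∈ R, ∀ t ∈ r.2, t.2 ≺ r.1) {n : ℕ}
    (hR : overlapsResolve R n = true) (w : Word) {a b : Word} {r : Rule} (hr : r ∈ R)
    (hw : w = a ++ r.1 ++ b) : nf φ R w = eval φ (fun t => nf φ R (a ++ t ++ b)) r.2 := by
  induction w using prec_wf.induction generalizing a b r with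
  | _ w ih =>
    have key : ∀ {a b a' b' : Word} {r r' : Rule}, r ∈ R → r' ∈ R → w = a ++ r.1 ++ b →
        w = a' ++ r'.1 ++ b' → a.length ≤ a'.length →
        eval φ (fun t => nf φ R (a ++ t ++ b)) r.2 =
          eval φ (fun t => nf φ R (a' ++ t ++ b')) r'.2 := by
      intro a b a' b' r r' hr hr' hw hw' hle
      obtain ⟨m, rfl⟩ : a <+: a' :=
        List.prefix_of_prefix_length_le (l₃ := w) ⟨r.1 ++ b, by simp [hw]⟩
          ⟨r'.1 ++ b', by simp [hw']⟩ hle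
      have hrb : r.1 ++ b = m ++ r'.1 ++ b' := by
        have := hw.symm.trans hw'
        simpa using this
      by_cases hm : r.1.length ≤ m.length
      · obtain ⟨m, rfl⟩ : r.1 <+: m :=
          List.prefix_of_prefix_length_le (l₃ := r.1 ++ b) ⟨b, rfl⟩
            ⟨r'.1 ++ b', by simp [hrb]⟩ hm
        obtain rfl : b = m ++ r'.1 ++ b' := by simpa using hrb
        have h₁ : ∀ t ∈ r.2, nf φ R (a ++ t.2 ++ (m ++ r'.1 ++ b')) =
            eval φ (fun t' => nf φ R (a ++ t.2 ++ (m ++ t' ++ b'))) r'.2 := by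
          intro t ht
          have hlt' := (hlt r hr t ht).append a (m ++ r'.1 ++ b')
          rw [← hw] at hlt'
          simpa using ih _ hlt' (a := a ++ t.2 ++ m) (b := b') hr' (by simp)
        have h₂ : ∀ t ∈ r'.2, nf φ R (a ++ (r.1 ++ m) ++ t.2 ++ b') =
            eval φ (fun t' => nf φ R (a ++ t' ++ (m ++ t.2 ++ b'))) r.2 := by
          intro t ht
          have hlt' := (hlt r' hr' t ht).append (a ++ (r.1 ++ m)) b'
          rw [← hw'] at hlt'
          simpa using ih _ hlt' (a := a) (b := m ++ t.2 ++ b') hr (by simp)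
        exact (eval_congr φ (G := fun t => eval φ (fun t' => nf φ R (a ++ t ++ (m ++ t' ++ b'))) r'.2)
          h₁).trans ((eval_comm φ _ _ _).trans (eval_congr φ (F := fun t =>
            nf φ R (a ++ (r.1 ++ m) ++ t ++ b')) h₂).symm)
      · have hd : m.length < r.1.length := not_le.1 hm
        obtain ⟨u, hu⟩ : m <+: r.1 :=
          List.prefix_of_prefix_length_le (l₃ := r.1 ++ b) ⟨r'.1 ++ b', by simp [hrb]⟩
            ⟨b, rfl⟩ hd.le
        have hub : u ++ b = r'.1 ++ b' := by
          rw [← hu] at hrb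
          simpa using hrb
        have hcheck := hR
        rw [overlapsResolve, List.all_eq_true] at hcheck
        have hcheck := List.all_eq_true.1 (List.all_eq_true.1 (hcheck r hr) r' hr') m.length
          (List.mem_range.2 hd)
        have hdrop : r.1.drop m.length = u := by simp [← hu]
        have htake : r.1.take m.length = m := by simp [← hu]
        rw [hdrop] at hcheck
        split_ifs at hcheck with hp
        · obtain ⟨v, hv⟩ := List.isPrefixOf_iff_prefix.1 hp
          obtain rfl : b = v ++ b' := by
            rw [← hv] at hub
            simpa using hub
          have hlen : r.1.length - m.length = u.length := by simp [← hu]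
          have hres : Respects φ R (fun x => a ++ x ++ b' ≺ w)
              (fun x => nf φ R (a ++ x ++ b')) := by
            intro s hs a₁ b₁ hlt₁
            refine ⟨by simpa using ih _ hlt₁ (a := a ++ a₁) (b := b₁ ++ b') hs (by simp), ?_⟩
            intro t ht
            have := (hlt s hs t ht).append (a ++ a₁) (b₁ ++ b')
            exact Prec.trans (by simpa using this) hlt₁
          have hzero := hres.eval_eq_zero ?_ hcheck
          · rw [sPolynomial, hlen, htake, ← hv, List.drop_left] at hzero
            simp only [eval_append, eval_wrapPoly, eval_smulPoly, φ.val_neg_one, neg_smul,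
              one_smul, ← sub_eq_add_neg, sub_eq_zero] at hzero
            simpa using hzero
          · intro t ht
            rw [sPolynomial, hlen, htake, ← hv, List.drop_left] at ht
            simp only [smulPoly, wrapPoly, List.mem_append, List.mem_map] at ht
            rcases ht with ⟨t, ht, rfl⟩ | ⟨_, ⟨t, ht, rfl⟩, rfl⟩
            · have := (hlt r hr t ht).append a (v ++ b')
              rw [← hw] at this
              simpa using this
            · have := (hlt r' hr' t ht).append (a ++ m) b'
              rw [← hw'] at this
              simpa using this
        · exfalso
          rw [Bool.not_eq_true', ← Bool.not_eq_true, List.isPrefixOf_iff_prefix] at hcheck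
          rw [List.isPrefixOf_iff_prefix] at hp
          rcases List.prefix_or_prefix_of_prefix (l₃ := u ++ b) ⟨b, rfl⟩ ⟨b', hub.symm⟩ with h | h
          · exact hp h
          · exact hcheck h
    obtain ⟨a', b', r', hr', hw', h⟩ := exists_nf_eq φ hlt (w := w)
      ⟨r, hr, a, b, hw.symm⟩
    rw [h]
    rcases le_total a.length a'.length with hle | hle
    · exact (key hr hr' hw hw' hle).symm
    · exact key hr' hr hw' hw hle

end NormalForm

/-! ### Evaluation in algebras -/

section Algebra

variable {K A : Type*} [Field K] [Ring A] [Algebra K A] (φ : CoefVal K) (X : Fin 11 → A)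

/-- The value of a word in an algebra. -/
def evalWord (w : Word) : A := (w.map X).prod

@[simp] theorem evalWord_nil : evalWord X [] = 1 := rfl

@[simp] theorem evalWord_cons (c : Fin 11) (w : Word) :
    evalWord X (c :: w) = X c * evalWord X w := by simp [evalWord]

@[simp] theorem evalWord_append (v w : Word) :
    evalWord X (v ++ w) = evalWord X v * evalWord X w := by simp [evalWord]

theorem eval_evalWord_append (a b : Word) (p : Poly) :
    eval φ (fun t => evalWord X (a ++ t ++ b)) p =
      evalWord X a * eval φ (evalWord X) p * evalWord X b := by
  induction p with
  | nil => simp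
  | cons t p ih =>
    rw [eval_cons, ih]
    simp [mul_add, add_mul, mul_assoc]

@[simp] theorem eval_mulPoly (p p' : Poly) :
    eval φ (evalWord X) (mulPoly p p') = eval φ (evalWord X) p * eval φ (evalWord X) p' := by
  induction p with
  | nil => simp [mulPoly]
  | cons t p ih =>
    have h : eval φ (evalWord X) (p'.map fun t' => (mulCoef t.1 t'.1, t.2 ++ t'.2)) =
        (φ.val t.1 • evalWord X t.2) * eval φ (evalWord X) p' := by
      clear ih
      induction p' with
      | nil => simp
      | cons t' p' ih => simp [ih, φ.val_mul, mul_add, mul_smul, smul_comm (φ.val t.1)]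
    rw [mulPoly] at ih ⊢
    rw [List.flatMap_cons, eval_append, ih, h, eval_cons, add_mul]

@[simp] theorem eval_letter (c : Fin 11) : eval φ (evalWord X) (letter c) = X c := by
  simp [letter, φ.val_one]

@[simp] theorem eval_commPoly (c : Coef) (p p' : Poly) :
    eval φ (evalWord X) (commPoly c p p') =
      eval φ (evalWord X) p * eval φ (evalWord X) p' +
        φ.val c • (eval φ (evalWord X) p' * eval φ (evalWord X) p) := by
  simp [commPoly]

/-- The rule `r` holds in an algebra. -/
def Holds (r : Rule) : Prop := evalWord X r.1 = eval φ (evalWord X) r.2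

variable {φ X}

theorem respects_of_holds {R : List Rule} (h : ∀ r ∈ R, Holds φ X r) :
    Respects φ R (fun _ => True) (evalWord X) := by
  refine fun r hr a b _ => ⟨?_, fun _ _ => trivial⟩
  rw [eval_evalWord_append, ← h r hr, evalWord_append, evalWord_append]

theorem eval_eq_zero_of_holds {R : List Rule} (h : ∀ r ∈ R, Holds φ X r) {n : ℕ} {p : Poly}
    (hp : reducesToZero R n p = true) : eval φ (evalWord X) p = 0 :=
  (respects_of_holds h).eval_eq_zero (fun _ _ => trivial) hp

theorem eval_sPolynomial {r r' : Rule} (h : Holds φ X r) (h' : Holds φ X r') {d : ℕ}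
    (hd : (r.1.drop d).isPrefixOf r'.1 = true) :
    eval φ (evalWord X) (sPolynomial r r' d) = 0 := by
  obtain ⟨v, hv⟩ := List.isPrefixOf_iff_prefix.1 hd
  have hdrop : r'.1.drop (r.1.length - d) = v := by simp [← hv]
  have h₁ : evalWord X r.1 = evalWord X (r.1.take d) * evalWord X (r.1.drop d) := by
    rw [← evalWord_append, List.take_append_drop]
  have h₂ : evalWord X r'.1 = evalWord X (r.1.drop d) * evalWord X v := by
    rw [← evalWord_append, hv]
  rw [sPolynomial, eval_append, eval_smulPoly, eval_wrapPoly, eval_wrapPoly,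
    eval_evalWord_append, eval_evalWord_append, ← h, ← h', hdrop, h₁, h₂, φ.val_neg_one]
  simp [mul_assoc]

theorem holds_of_derivable {base : List Poly} (hbase : ∀ p ∈ base, eval φ (evalWord X) p = 0)
    {n : ℕ} {D : List (Rule × Source × Coef)} {R : List Rule} (hR : ∀ r ∈ R, Holds φ X r)
    (hD : derivable base n R D = true) : ∀ d ∈ D, Holds φ X d.1 := by
  induction D generalizing R with
  | nil => simp
  | cons d D ih =>
    simp only [derivable, Bool.and_eq_true, bne_iff_ne] at hD
    obtain ⟨⟨hc, hred⟩, hD⟩ := hD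
    have hsrc : eval φ (evalWord X) (d.2.1.poly base R) = 0 := by
      rcases d.2.1 with i | ⟨i, j, e⟩
      · rw [Source.poly]
        cases hi : base[i]? with
        | none => simp
        | some p => simpa using hbase p (List.mem_of_getElem? hi)
      · rw [Source.poly]
        split
        · rename_i r r' hr hr'
          split_ifs with hp
          · exact eval_sPolynomial (hR r (List.mem_of_getElem? hr))
              (hR r' (List.mem_of_getElem? hr')) hp
          · simp
        · simp
    have hd : Holds φ X d.1 := by
      have := eval_eq_zero_of_holds hR hred
      rw [eval_append, hsrc, zero_add, eval_toPoly, φ.val_mul, φ.val_neg_one] at this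
      rw [Holds, ← sub_eq_zero]
      exact (smul_eq_zero.1 this).resolve_left
        (mul_ne_zero (neg_ne_zero.2 one_ne_zero) (φ.val_ne_zero _ hc))
    refine List.forall_mem_cons.2 ⟨hd, ih (R := R ++ [d.1]) (fun r hr => ?_) hD⟩
    rcases List.mem_append.1 hr with hr | hr
    · exact hR r hr
    · rwa [List.mem_singleton.1 hr]

end Algebra

/-! ### The regular representation -/

section LeftMul

variable {K : Type*} [Field K] (φ : CoefVal K) (R : List Rule)

/-- Left multiplication by a letter on the space spanned by the irreducible words. -/
def leftMul (c : Fin 11) : Module.End K (Word →₀ K) :=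
  Finsupp.linearCombination K fun w => nf φ R (c :: w)

variable {R}

theorem leftMul_single (c : Fin 11) (w : Word) :
    leftMul φ R c (Finsupp.single w 1) = nf φ R (c :: w) := by
  simp [leftMul]

theorem leftMul_nf (hlt : ∀ r ∈ R, ∀ t ∈ r.2, t.2 ≺ r.1) {n : ℕ}
    (hR : overlapsResolve R n = true) (c : Fin 11) (w : Word) :
    leftMul φ R c (nf φ R w) = nf φ R (c :: w) := by
  induction w using prec_wf.induction with
  | _ w ih =>
    by_cases hw : Reducible R w
    · obtain ⟨a, b, r, hr, rfl, h⟩ := exists_nf_eq φ hlt hw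
      rw [h, map_eval, nf_eq_eval φ hlt hR _ hr (a := c :: a) (b := b) (by simp)]
      exact eval_congr φ fun t ht => ih _ ((hlt r hr t ht).append a b)
    · rw [nf_of_not_reducible φ hw, leftMul_single]

theorem evalWord_leftMul_nf (hlt : ∀ r ∈ R, ∀ t ∈ r.2, t.2 ≺ r.1) {n : ℕ}
    (hR : overlapsResolve R n = true) (v w : Word) :
    evalWord (leftMul φ R) v (nf φ R w) = nf φ R (v ++ w) := by
  induction v with
  | nil => simp
  | cons c v ih => simp [ih, leftMul_nf φ hlt hR]

theorem evalWord_leftMul_single (hlt : ∀ r ∈ R, ∀ t ∈ r.2, t.2 ≺ r.1) {n : ℕ}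
    (hR : overlapsResolve R n = true) {v : Word} (hv : v ≠ []) (w : Word) :
    evalWord (leftMul φ R) v (Finsupp.single w 1) = nf φ R (v ++ w) := by
  obtain ⟨v, c, rfl⟩ := (List.eq_nil_or_concat v).resolve_left hv
  rw [List.concat_eq_append, evalWord_append, evalWord_cons, evalWord_nil, mul_one, Module.End.mul_apply,
    leftMul_single, evalWord_leftMul_nf φ hlt hR]
  simp

theorem holds_leftMul (hlt : ∀ r ∈ R, ∀ t ∈ r.2, t.2 ≺ r.1) {n : ℕ}
    (hR : overlapsResolve R n = true) {r : Rule} (hr : r ∈ R) (hne : r.1 ≠ [])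
    (hne' : ∀ t ∈ r.2, t.2 ≠ []) : Holds φ (leftMul φ R) r := by
  refine Finsupp.lhom_ext' fun w => LinearMap.ext_ring ?_
  have h : (eval φ (evalWord (leftMul φ R)) r.2) (Finsupp.single w 1) =
      eval φ (fun t => evalWord (leftMul φ R) t (Finsupp.single w 1)) r.2 :=
    map_eval φ (LinearMap.applyₗ (Finsupp.single w (1 : K))) _ _
  simp only [LinearMap.comp_apply, Finsupp.lsingle_apply]
  rw [h, evalWord_leftMul_single φ hlt hR hne, nf_eq_eval φ hlt hR _ hr (a := []) (b := w) (by simp)]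
  exact eval_congr φ fun t ht => by
    rw [evalWord_leftMul_single φ hlt hR (hne' t ht), List.nil_append]

end LeftMul

/-! ### The relations as polynomials in the letters -/

section Relations

variable {k} {q12 q13 q23}

/-- Evaluation of coefficients at given nonzero parameters. -/
def qVal [CharZero k] (h12 : q12 ≠ 0) (h13 : q13 ≠ 0) (h23 : q23 ≠ 0) : CoefVal k where
  val c := c.1 * q12 ^ c.2.1 * q13 ^ c.2.2.1 * q23 ^ c.2.2.2
  val_one := by simp
  val_mul c d := by
    simp only [mulCoef, Int.cast_mul, zpow_add₀ h12, zpow_add₀ h13, zpow_add₀ h23]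
    ring
  val_add m n e := by
    push_cast
    ring
  val_ne_zero c hc := by
    have : (c.1 : k) ≠ 0 := Int.cast_ne_zero.2 hc
    positivity

variable (k q12 q13 q23) in
/-- The elements of the free algebra denoted by the letters. -/
def gen : Fin 11 → FreeAlgebra k (Fin 4) :=
  ![x1 k, x3 k, y k, z111 k q12 q13 q23, z011 k q12 q13 q23, z101 k q12 q13 q23,
    z110 k q12 q13 q23, z001 k q12 q13 q23, z010 k q12 q13 q23, z100 k q12, z000 k]

@[simp] theorem gen_apply :
    gen k q12 q13 q23 0 = x1 k ∧ gen k q12 q13 q23 1 = x3 k ∧ gen k q12 q13 q23 2 = y k ∧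
    gen k q12 q13 q23 3 = z111 k q12 q13 q23 ∧ gen k q12 q13 q23 4 = z011 k q12 q13 q23 ∧
    gen k q12 q13 q23 5 = z101 k q12 q13 q23 ∧ gen k q12 q13 q23 6 = z110 k q12 q13 q23 ∧
    gen k q12 q13 q23 7 = z001 k q12 q13 q23 ∧ gen k q12 q13 q23 8 = z010 k q12 q13 q23 ∧
    gen k q12 q13 q23 9 = z100 k q12 ∧ gen k q12 q13 q23 10 = x2 k :=
  ⟨rfl, rfl, rfl, rfl, rfl, rfl, rfl, rfl, rfl, rfl, rfl⟩

variable [CharZero k] (h12 : q12 ≠ 0) (h13 : q13 ≠ 0) (h23 : q23 ≠ 0)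

theorem qVal_val (c : Coef) : (qVal h12 h13 h23).val c =
    c.1 * q12 ^ c.2.1 * q13 ^ c.2.2.1 * q23 ^ c.2.2.2 := rfl

theorem eval_sPoly :
    eval (qVal h12 h13 h23) (evalWord (gen k q12 q13 q23)) sPoly = s k q13 := by
  simp [sPoly, s, qVal_val]

theorem eval_rPoly :
    eval (qVal h12 h13 h23) (evalWord (gen k q12 q13 q23)) rPoly = r k q13 := by
  simp [rPoly, r, eval_sPoly, qVal_val]

theorem eval_x13Poly :
    eval (qVal h12 h13 h23) (evalWord (gen k q12 q13 q23)) x13Poly = x13 k q13 := by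
  simp [x13Poly, x13, qVal_val, sub_eq_add_neg]

theorem eval_YPoly :
    eval (qVal h12 h13 h23) (evalWord (gen k q12 q13 q23)) YPoly = Y k q12 q13 q23 := by
  simp [YPoly, Y]

theorem rels_eq : rels k q12 q13 q23 =
    {a | a ∈ relPolys.map (eval (qVal h12 h13 h23) (evalWord (gen k q12 q13 q23)))} := by
  ext a
  simp only [rels, relPolys, Set.mem_insert_iff, Set.mem_singleton_iff, Set.mem_ofPred_eq,
    List.map_cons, List.map_nil, List.mem_cons, List.not_mem_nil, or_false]
  simp [eval_sPoly, eval_rPoly, eval_x13Poly, eval_YPoly, qVal_val, pow_two,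
    sub_eq_add_neg]

theorem eval_defPolys : ∀ p ∈ defPolys,
    eval (qVal h12 h13 h23) (evalWord (gen k q12 q13 q23)) p = 0 := by
  simp only [defPolys, List.forall_mem_cons]
  refine ⟨?_, ?_, ?_, ?_, ?_, ?_, ?_, by simp⟩
  · simp [qVal_val, z100, sub_eq_add_neg]; module
  · simp [qVal_val, z010]; module
  · simp [qVal_val, z110]; module
  · simp [qVal_val, z001]; module
  · simp [qVal_val, z101, sub_eq_add_neg]; module
  · simp [qVal_val, z011, sub_eq_add_neg]; module
  · simp [qVal_val, z111]; module

end Relations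

/-! ### Leading words -/

section Lead

variable {K A : Type*} [Field K] [Ring A] [Algebra K A] (X : Fin 11 → A)

/-- The span of the values of the words smaller than `w`. -/
def below (w : Word) : Submodule K A := Submodule.span K (evalWord X '' {v | v ≺ w})

variable (K) in
/-- `x` is the value of `w` up to a combination of values of smaller words. -/
def IsLead (w : Word) (x : A) : Prop := x - evalWord X w ∈ below (K := K) X w

variable {X}

theorem evalWord_mem_below {v w : Word} (h : v ≺ w) : evalWord X v ∈ below (K := K) X w :=
  Submodule.subset_span ⟨v, h, rfl⟩

theorem mul_mem_below {w w' : Word} {x : A} (a b : Word) (hw : a ++ w ++ b = w')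
    (hx : x ∈ below (K := K) X w) : evalWord X a * x * evalWord X b ∈ below (K := K) X w' := by
  subst hw
  induction hx using Submodule.span_induction with
  | mem x hx =>
    obtain ⟨v, hv, rfl⟩ := hx
    rw [← evalWord_append, ← evalWord_append]
    exact evalWord_mem_below (hv.append a b)
  | zero => simp
  | add x y _ _ hx hy => simpa [mul_add, add_mul] using Submodule.add_mem _ hx hy
  | smul c x _ hx => simpa using Submodule.smul_mem _ c hx

theorem mul_mem_below_append {w w' : Word} {x x' : A} (hx : x ∈ below (K := K) X w)
    (hx' : x' ∈ below (K := K) X w') : x * x' ∈ below (K := K) X (w ++ w') := by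
  induction hx using Submodule.span_induction with
  | mem x hx =>
    obtain ⟨v, hv, rfl⟩ := hx
    have h := mul_mem_below v [] rfl hx'
    rw [evalWord_nil, mul_one, List.append_nil] at h
    refine Submodule.span_mono (Set.image_mono fun u hu => ?_) h
    exact Prec.trans hu (by simpa using hv.append [] w')
  | zero => simp
  | add x y _ _ hx hy => simpa [add_mul] using Submodule.add_mem _ hx hy
  | smul c x _ hx => simpa using Submodule.smul_mem _ c hx

theorem IsLead.mul {w w' : Word} {x x' : A} (h : IsLead K X w x) (h' : IsLead K X w' x') :
    IsLead K X (w ++ w') (x * x') := by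
  have h₁ := mul_mem_below (w' := w ++ w') w [] (by simp) h'
  have h₂ := mul_mem_below [] w' rfl h
  have h₃ := mul_mem_below_append h h'
  rw [evalWord_nil, mul_one] at h₁
  rw [evalWord_nil, one_mul] at h₂
  rw [IsLead, evalWord_append]
  convert Submodule.add_mem _ (Submodule.add_mem _ h₁ h₂) h₃ using 1
  noncomm_ring

theorem isLead_evalWord (w : Word) : IsLead K X w (evalWord X w) := by simp [IsLead]

/-- The `n`-fold repetition of a word. -/
def block (w : Word) (n : ℕ) : Word := (List.replicate n w).flatten

@[simp] theorem block_zero (w : Word) : block w 0 = [] := rfl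

@[simp] theorem block_succ (w : Word) (n : ℕ) : block w (n + 1) = w ++ block w n := by
  simp [block, List.replicate_succ]

@[simp] theorem block_one (w : Word) : block w 1 = w := by simp [block]

theorem IsLead.pow {w : Word} {x : A} (h : IsLead K X w x) (n : ℕ) :
    IsLead K X (block w n) (x ^ n) := by
  induction n with
  | zero => simpa using isLead_evalWord (K := K) (X := X) []
  | succ n ih =>
    rw [block_succ, pow_succ']
    exact h.mul ih

theorem isLead_letter (c : Fin 11) : IsLead K X [c] (X c) := by
  simpa using isLead_evalWord (K := K) (X := X) [c]

theorem isLead_eval (φ : CoefVal K) {w : Word} {p : Poly} (hp : ∀ t ∈ p, t.2 ≺ w) :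
    IsLead K X w (eval φ (evalWord X) (((1, 0, 0, 0), w) :: p)) := by
  rw [IsLead, eval_cons, φ.val_one, one_smul, add_sub_cancel_left]
  exact eval_mem φ fun t ht => evalWord_mem_below (hp t ht)

end Lead

/-! ### The words of the PBW monomials -/

/-- The leading word of the part of a PBW monomial without factors `z…` and `Y`. -/
def tailWord (a₁ a₂ a₃ a₄ a₅ a₆ : Fin 2) : Word :=
  block [2] a₁ ++ (block [1, 2] a₂ ++ (block [0, 1, 2] a₃ ++
    (block [1] a₄ ++ (block [0, 1] a₅ ++ block [0] a₆))))

/-- The leading word of a PBW monomial. -/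
def Idx.word (i : Idx) : Word :=
  block [10] i.m000 ++ (block [9] i.m100 ++ (block [8] i.m010 ++ (block [7] i.m001 ++
    (block [6, 7] i.m ++ (block [6] i.m110 ++ (block [5] i.m101 ++ (block [4] i.m011 ++
      (block [3] i.m111 ++ tailWord i.a1 i.a2 i.a3 i.a4 i.a5 i.a6))))))))

section Monomials

variable {k} {q12 q13 q23}

variable (k q12 q13 q23) in
/-- The PBW monomial with a given index, in the free algebra. -/
def freeMon (i : Idx) : FreeAlgebra k (Fin 4) :=
  z000 k ^ i.m000 * z100 k q12 ^ (i.m100 : ℕ) * z010 k q12 q13 q23 ^ (i.m010 : ℕ) *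
    z001 k q12 q13 q23 ^ (i.m001 : ℕ) * Y k q12 q13 q23 ^ i.m *
    z110 k q12 q13 q23 ^ i.m110 * z101 k q12 q13 q23 ^ (i.m101 : ℕ) *
    z011 k q12 q13 q23 ^ (i.m011 : ℕ) * z111 k q12 q13 q23 ^ i.m111 *
    y k ^ (i.a1 : ℕ) * s k q13 ^ (i.a2 : ℕ) * r k q13 ^ (i.a3 : ℕ) *
    x3 k ^ (i.a4 : ℕ) * x13 k q13 ^ (i.a5 : ℕ) * x1 k ^ (i.a6 : ℕ)

theorem map_evalWord {A B : Type*} [Ring A] [Algebra k A] [Ring B] [Algebra k B] (ψ : A →ₐ[k] B)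
    (X : Fin 11 → A) (w : Word) : ψ (evalWord X w) = evalWord (fun c => ψ (X c)) w := by
  induction w with
  | nil => simp
  | cons c w ih => simp [ih]

theorem map_eval_gen {A : Type*} [Ring A] [Algebra k A] {ψ : FreeAlgebra k (Fin 4) →ₐ[k] A}
    {X : Fin 11 → A} (hX : ∀ c, ψ (gen k q12 q13 q23 c) = X c) (φ : CoefVal k) (p : Poly) :
    ψ (eval φ (evalWord (gen k q12 q13 q23)) p) = eval φ (evalWord X) p := by
  simp only [map_eval, map_evalWord, hX]

variable [CharZero k] (h12 : q12 ≠ 0) (h13 : q13 ≠ 0) (h23 : q23 ≠ 0)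

include h12 h13 h23 in
theorem isLead_map_freeMon {A : Type*} [Ring A] [Algebra k A]
    (ψ : FreeAlgebra k (Fin 4) →ₐ[k] A) (i : Idx) :
    IsLead k (fun c => ψ (gen k q12 q13 q23 c)) i.word (ψ (freeMon k q12 q13 q23 i)) := by
  have hpoly : ∀ p : Poly, ψ (eval (qVal h12 h13 h23) (evalWord (gen k q12 q13 q23)) p) =
      eval (qVal h12 h13 h23) (evalWord fun c => ψ (gen k q12 q13 q23 c)) p :=
    map_eval_gen (fun _ => rfl) _
  have hs : IsLead k (fun c => ψ (gen k q12 q13 q23 c)) [1, 2] (ψ (s k q13)) := by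
    rw [← eval_sPoly h12 h13 h23, hpoly]
    exact isLead_eval _ (by decide)
  have hr : IsLead k (fun c => ψ (gen k q12 q13 q23 c)) [0, 1, 2] (ψ (r k q13)) := by
    rw [← eval_rPoly h12 h13 h23, hpoly]
    exact isLead_eval _ (by decide)
  have hx : IsLead k (fun c => ψ (gen k q12 q13 q23 c)) [0, 1] (ψ (x13 k q13)) := by
    rw [← eval_x13Poly h12 h13 h23, hpoly]
    exact isLead_eval _ (by decide)
  have hY : IsLead k (fun c => ψ (gen k q12 q13 q23 c)) [6, 7] (ψ (Y k q12 q13 q23)) := by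
    rw [← eval_YPoly h12 h13 h23, hpoly]
    exact isLead_eval _ (by decide)
  have hl := isLead_letter (K := k) (X := fun c => ψ (gen k q12 q13 q23 c))
  simp only [Idx.word, tailWord, freeMon, map_mul, map_pow, mul_assoc]
  exact ((hl 10).pow _).mul <| ((hl 9).pow _).mul <| ((hl 8).pow _).mul <| ((hl 7).pow _).mul <|
    (hY.pow _).mul <| ((hl 6).pow _).mul <| ((hl 5).pow _).mul <| ((hl 4).pow _).mul <|
    ((hl 3).pow _).mul <| ((hl 2).pow _).mul <| (hs.pow _).mul <| (hr.pow _).mul <|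
    ((hl 1).pow _).mul <| (hx.pow _).mul <| (hl 0).pow _

end Monomials

/-! ### The irreducible words -/

section Words

theorem rules_prec : ∀ r ∈ rules, ∀ t ∈ r.2, t.2 ≺ r.1 := by decide +kernel

theorem rules_ne_nil : ∀ r ∈ rules, r.1 ≠ [] ∧ ∀ t ∈ r.2, t.2 ≠ [] := by decide +kernel

theorem count_block (c : Fin 11) (w : Word) (n : ℕ) :
    (block w n).count c = n * w.count c := by
  induction n with
  | zero => simp
  | succ n ih => simp [ih, add_mul, add_comm]

theorem filter_block (p : Fin 11 → Bool) (w : Word) (n : ℕ) :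
    (block w n).filter p = block (w.filter p) n := by
  induction n with
  | zero => simp
  | succ n ih => simp [ih]

@[simp] theorem block_nil (n : ℕ) : block [] n = [] := by
  induction n with
  | zero => simp
  | succ n ih => simp [ih]

theorem mem_tailWord_lt : ∀ a₁ a₂ a₃ a₄ a₅ a₆ : Fin 2,
    ∀ c ∈ tailWord a₁ a₂ a₃ a₄ a₅ a₆, c < 3 := by decide +kernel

theorem tailWord_injective : ∀ a₁ a₂ a₃ a₄ a₅ a₆ b₁ b₂ b₃ b₄ b₅ b₆ : Fin 2,
    tailWord a₁ a₂ a₃ a₄ a₅ a₆ = tailWord b₁ b₂ b₃ b₄ b₅ b₆ →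
      a₁ = b₁ ∧ a₂ = b₂ ∧ a₃ = b₃ ∧ a₄ = b₄ ∧ a₅ = b₅ ∧ a₆ = b₆ := by decide +kernel

theorem word_injective : Function.Injective Idx.word := by
  rintro ⟨m000, m100, m010, m001, m, m110, m101, m011, m111, a₁, a₂, a₃, a₄, a₅, a₆⟩
    ⟨n000, n100, n010, n001, n, n110, n101, n011, n111, b₁, b₂, b₃, b₄, b₅, b₆⟩ h
  have hf : ∀ p : Fin 11 → Bool, (∀ c, 3 ≤ c → p c = false) → (∀ c, c < 3 → p c = true) →
      tailWord a₁ a₂ a₃ a₄ a₅ a₆ = tailWord b₁ b₂ b₃ b₄ b₅ b₆ := by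
    intro p hp hp'
    have := congrArg (List.filter p) h
    have e₁ : (tailWord a₁ a₂ a₃ a₄ a₅ a₆).filter p = tailWord a₁ a₂ a₃ a₄ a₅ a₆ :=
      List.filter_eq_self.2 fun c hc => hp' c (mem_tailWord_lt _ _ _ _ _ _ c hc)
    have e₂ : (tailWord b₁ b₂ b₃ b₄ b₅ b₆).filter p = tailWord b₁ b₂ b₃ b₄ b₅ b₆ :=
      List.filter_eq_self.2 fun c hc => hp' c (mem_tailWord_lt _ _ _ _ _ _ c hc)
    have hpz : p 3 = false ∧ p 4 = false ∧ p 5 = false ∧ p 6 = false ∧ p 7 = false ∧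
        p 8 = false ∧ p 9 = false ∧ p 10 = false := by
      refine ⟨?_, ?_, ?_, ?_, ?_, ?_, ?_, ?_⟩ <;> exact hp _ (by decide)
    simpa [Idx.word, filter_block, hpz, e₁, e₂] using this
  obtain ⟨rfl, rfl, rfl, rfl, rfl, rfl⟩ := tailWord_injective _ _ _ _ _ _ _ _ _ _ _ _
    (hf (fun c => decide (c < 3)) (by simp) (by simp))
  have hc := fun c : Fin 11 => congrArg (List.count c) h
  simp only [Idx.word, List.count_append, count_block] at hc
  have h10 := hc 10
  have h9 := hc 9
  have h8 := hc 8
  have h7 := hc 7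
  have h6 := hc 6
  have h5 := hc 5
  have h4 := hc 4
  have h3 := hc 3
  simp at h10 h9 h8 h7 h6 h5 h4 h3
  have h67 := congrArg (List.filter fun c => c = 6 ∨ c = 7) h
  simp [Idx.word, filter_block] at h67
  have h001 : m001 = n001 := by
    rcases m with _ | m <;> rcases n with _ | n <;> fin_cases m001 <;> fin_cases n001 <;>
      simp at h67 h7 ⊢ <;> omega
  simp_all [Fin.ext_iff]

/-- For `3 ≤ c`, the leading words of rules starting with `c` are of the form `[c, d]` with
`bound c < d`, except for `[6, 6, 7]`. -/
def bound : Fin 11 → Fin 11 := ![0, 0, 0, 3, 3, 4, 7, 6, 7, 8, 10]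

theorem rules_lead : ∀ r ∈ rules, ∀ c, 3 ≤ c → r.1.head? = some c →
    (c = 6 ∧ r.1 = [6, 6, 7]) ∨ ∃ d, bound c < d ∧ r.1 = [c, d] := by decide +kernel

/-- `w` is irreducible, and its first letter is at most `n`. -/
def IrredLE (n : Fin 11) (w : Word) : Prop := ¬ Reducible rules w ∧ ∀ d ∈ w.head?, d ≤ n

theorem IrredLE.mono {n n' : Fin 11} {w : Word} (h : IrredLE n w) (hn : n ≤ n') : IrredLE n' w :=
  ⟨h.1, fun d hd => (h.2 d hd).trans hn⟩

theorem IrredLE.cons {c : Fin 11} {w : Word} (h : IrredLE (bound c) w) (hc : 3 ≤ c)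
    (h67 : c = 6 → ¬ [6, 7] <+: w) : IrredLE c (c :: w) := by
  refine ⟨?_, by simp⟩
  rintro ⟨r, hr, hw⟩
  rcases List.infix_cons_iff.1 hw with hw | hw
  · have hhead : r.1.head? = some c := by
      have hne := (rules_ne_nil r hr).1
      obtain ⟨t, ht⟩ := hw
      cases hr1 : r.1 with
      | nil => exact absurd hr1 hne
      | cons d u =>
        rw [hr1] at ht
        simp_all
    rcases rules_lead r hr c hc hhead with ⟨rfl, h₁⟩ | ⟨d, hd, h₁⟩
    · rw [h₁, List.cons_prefix_cons] at hw
      exact h67 rfl hw.2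
    · rw [h₁, List.cons_prefix_cons] at hw
      obtain ⟨t, rfl⟩ := hw.2
      exact absurd (h.2 d (by simp)) (not_le.2 hd)
  · exact h.1 ⟨r, hr, hw⟩

theorem IrredLE.block {c : Fin 11} {w : Word} (h : IrredLE c w) (hc : 3 ≤ c) (hb : c ≤ bound c)
    (h6 : c ≠ 6) (n : ℕ) : IrredLE c (block [c] n ++ w) := by
  induction n with
  | zero => simpa using h
  | succ n ih => simpa using (ih.mono hb).cons hc fun h => absurd h h6

theorem IrredLE.block_fin {c : Fin 11} {w : Word} (h : IrredLE (bound c) w) (hc : 3 ≤ c)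
    (hb : bound c ≤ c) (h6 : c ≠ 6) (n : Fin 2) : IrredLE c (Stmt10.block [c] n ++ w) := by
  fin_cases n
  · simpa using h.mono hb
  · simpa using h.cons hc fun h => absurd h h6

theorem IrredLE.block_six {w : Word} (h : IrredLE 5 w) (n : ℕ) :
    IrredLE 6 (Stmt10.block [6] n ++ w) ∧ ¬ [6, 7] <+: Stmt10.block [6] n ++ w := by
  induction n with
  | zero =>
    refine ⟨by simpa using h.mono (by decide), ?_⟩
    rintro ⟨t, ht⟩
    rw [block_zero, List.nil_append] at ht
    exact absurd (h.2 6 (by simp [← ht])) (by decide)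
  | succ n ih =>
    refine ⟨by simpa using (ih.1.mono (by decide)).cons (by decide) fun _ => ih.2, ?_⟩
    rw [block_succ, List.append_assoc, List.singleton_append, List.cons_prefix_cons]
    rintro ⟨-, t, ht⟩
    exact absurd (ih.1.2 7 (by simp [← ht])) (by decide)

theorem IrredLE.block_six_seven {w : Word} (h : IrredLE 6 w) (n : ℕ) :
    IrredLE 6 (Stmt10.block [6, 7] n ++ w) := by
  induction n with
  | zero => simpa using h
  | succ n ih =>
    have h7 : IrredLE 7 (7 :: (Stmt10.block [6, 7] n ++ w)) := ih.cons (c := 7) (by decide) (by simp)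
    simpa using h7.cons (c := 6) (by decide) (by simp)

theorem irredLE_tailWord : ∀ a₁ a₂ a₃ a₄ a₅ a₆ : Fin 2,
    IrredLE 3 (tailWord a₁ a₂ a₃ a₄ a₅ a₆) := by
  unfold IrredLE Reducible
  decide +kernel

theorem word_not_reducible (i : Idx) : ¬ Reducible rules i.word := by
  have h3 := (irredLE_tailWord i.a1 i.a2 i.a3 i.a4 i.a5 i.a6).block (by decide) (by decide)
    (by decide) i.m111
  have h4 := IrredLE.block_fin (c := 4) h3 (by decide) (by decide) (by decide) i.m011
  have h5 := IrredLE.block_fin (c := 5) h4 (by decide) (by decide) (by decide) i.m101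
  have h6 := (h5.block_six i.m110).1.block_six_seven i.m
  have h7 := IrredLE.block_fin (c := 7) h6 (by decide) (by decide) (by decide) i.m001
  have h8 := IrredLE.block_fin (c := 8) h7 (by decide) (by decide) (by decide) i.m010
  have h9 := IrredLE.block_fin (c := 9) h8 (by decide) (by decide) (by decide) i.m100
  exact ((h9.mono (by decide)).block (c := 10) (by decide) (by decide) (by decide) i.m000).1

theorem reducible_cons_cons (c d : Fin 11) (w : Word) (hd : 3 ≤ d)
    (hcd : c < d ∧ ¬ (c = 6 ∧ d = 7) ∨ c = d ∧ d ≠ 3 ∧ d ≠ 6 ∧ d ≠ 10) :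
    Reducible rules (c :: d :: w) := by
  have h : ∀ c d : Fin 11, 3 ≤ d →
      (c < d ∧ ¬ (c = 6 ∧ d = 7) ∨ c = d ∧ d ≠ 3 ∧ d ≠ 6 ∧ d ≠ 10) →
      ∃ r ∈ rules, r.1 = [c, d] := by decide +kernel
  obtain ⟨r, hr, h⟩ := h c d hd hcd
  exact ⟨r, hr, h ▸ ⟨[], w, by simp⟩⟩

theorem reducible_six_six_seven (w : Word) : Reducible rules (6 :: 6 :: 7 :: w) := by
  have h : ∃ r ∈ rules, r.1 = [6, 6, 7] := by decide +kernel
  obtain ⟨r, hr, h⟩ := h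
  exact ⟨r, hr, h ▸ ⟨[], w, by simp⟩⟩

theorem cons_tailWord : ∀ c : Fin 11, c < 3 → ∀ a₁ a₂ a₃ a₄ a₅ a₆ : Fin 2,
    Reducible rules (c :: tailWord a₁ a₂ a₃ a₄ a₅ a₆) ∨
      ∃ b₁ b₂ b₃ b₄ b₅ b₆, c :: tailWord a₁ a₂ a₃ a₄ a₅ a₆ = tailWord b₁ b₂ b₃ b₄ b₅ b₆ := by
  unfold Reducible
  decide +kernel

theorem cons_word (c : Fin 11) (i : Idx) :
    Reducible rules (c :: i.word) ∨ ∃ j : Idx, c :: i.word = j.word := by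
  have hred (d : Fin 11) (w : Word) (h : i.word = d :: w) (hd : 3 ≤ d)
      (hcd : c < d ∧ ¬ (c = 6 ∧ d = 7) ∨ c = d ∧ d ≠ 3 ∧ d ≠ 6 ∧ d ≠ 10) :
      Reducible rules (c :: i.word) ∨ ∃ j : Idx, c :: i.word = j.word :=
    Or.inl (h ▸ reducible_cons_cons c d w hd hcd)
  obtain ⟨m000, m100, m010, m001, m, m110, m101, m011, m111, a₁, a₂, a₃, a₄, a₅, a₆⟩ := i
  obtain rfl | h10 : c = 10 ∨ c < 10 := by omega
  · exact Or.inr ⟨⟨m000 + 1, m100, m010, m001, m, m110, m101, m011, m111, a₁, a₂, a₃, a₄, a₅, a₆⟩, rfl⟩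
  obtain _ | m000 := m000
  swap
  · exact hred 10 _ rfl (by decide) (by omega)
  obtain rfl | h9 : c = 9 ∨ c < 9 := by omega
  · obtain rfl | rfl : m100 = 0 ∨ m100 = 1 := by omega
    · exact Or.inr ⟨⟨0, 1, m010, m001, m, m110, m101, m011, m111, a₁, a₂, a₃, a₄, a₅, a₆⟩, rfl⟩
    · exact hred 9 _ rfl (by decide) (by omega)
  obtain rfl | rfl : m100 = 0 ∨ m100 = 1 := by omega
  swap
  · exact hred 9 _ rfl (by decide) (by omega)
  obtain rfl | h8 : c = 8 ∨ c < 8 := by omega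
  · obtain rfl | rfl : m010 = 0 ∨ m010 = 1 := by omega
    · exact Or.inr ⟨⟨0, 0, 1, m001, m, m110, m101, m011, m111, a₁, a₂, a₃, a₄, a₅, a₆⟩, rfl⟩
    · exact hred 8 _ rfl (by decide) (by omega)
  obtain rfl | rfl : m010 = 0 ∨ m010 = 1 := by omega
  swap
  · exact hred 8 _ rfl (by decide) (by omega)
  obtain rfl | h7 : c = 7 ∨ c < 7 := by omega
  · obtain rfl | rfl : m001 = 0 ∨ m001 = 1 := by omega
    · exact Or.inr ⟨⟨0, 0, 0, 1, m, m110, m101, m011, m111, a₁, a₂, a₃, a₄, a₅, a₆⟩, rfl⟩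
    · exact hred 7 _ rfl (by decide) (by omega)
  obtain rfl | h6 : c = 6 ∨ c < 6 := by omega
  · obtain rfl | rfl : m001 = 0 ∨ m001 = 1 := by omega
    · obtain _ | m := m
      · exact Or.inr ⟨⟨0, 0, 0, 0, 0, m110 + 1, m101, m011, m111, a₁, a₂, a₃, a₄, a₅, a₆⟩, rfl⟩
      · exact Or.inl (reducible_six_six_seven _)
    · exact Or.inr ⟨⟨0, 0, 0, 0, m + 1, m110, m101, m011, m111, a₁, a₂, a₃, a₄, a₅, a₆⟩, rfl⟩
  obtain rfl | rfl : m001 = 0 ∨ m001 = 1 := by omega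
  swap
  · exact hred 7 _ rfl (by decide) (by omega)
  obtain _ | m := m
  swap
  · exact hred 6 _ rfl (by decide) (by omega)
  obtain _ | m110 := m110
  swap
  · exact hred 6 _ rfl (by decide) (by omega)
  obtain rfl | h5 : c = 5 ∨ c < 5 := by omega
  · obtain rfl | rfl : m101 = 0 ∨ m101 = 1 := by omega
    · exact Or.inr ⟨⟨0, 0, 0, 0, 0, 0, 1, m011, m111, a₁, a₂, a₃, a₄, a₅, a₆⟩, rfl⟩
    · exact hred 5 _ rfl (by decide) (by omega)
  obtain rfl | rfl : m101 = 0 ∨ m101 = 1 := by omega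
  swap
  · exact hred 5 _ rfl (by decide) (by omega)
  obtain rfl | h4 : c = 4 ∨ c < 4 := by omega
  · obtain rfl | rfl : m011 = 0 ∨ m011 = 1 := by omega
    · exact Or.inr ⟨⟨0, 0, 0, 0, 0, 0, 0, 1, m111, a₁, a₂, a₃, a₄, a₅, a₆⟩, rfl⟩
    · exact hred 4 _ rfl (by decide) (by omega)
  obtain rfl | rfl : m011 = 0 ∨ m011 = 1 := by omega
  swap
  · exact hred 4 _ rfl (by decide) (by omega)
  obtain rfl | h3 : c = 3 ∨ c < 3 := by omega
  · exact Or.inr ⟨⟨0, 0, 0, 0, 0, 0, 0, 0, m111 + 1, a₁, a₂, a₃, a₄, a₅, a₆⟩, rfl⟩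
  obtain _ | m111 := m111
  swap
  · exact hred 3 _ rfl (by decide) (by omega)
  refine (cons_tailWord c h3 a₁ a₂ a₃ a₄ a₅ a₆).imp id ?_
  rintro ⟨b₁, b₂, b₃, b₄, b₅, b₆, h⟩
  exact ⟨⟨0, 0, 0, 0, 0, 0, 0, 0, 0, b₁, b₂, b₃, b₄, b₅, b₆⟩, h⟩

theorem reducible_or_eq_word (w : Word) : Reducible rules w ∨ ∃ i : Idx, w = i.word := by
  induction w with
  | nil => exact Or.inr ⟨⟨0, 0, 0, 0, 0, 0, 0, 0, 0, 0, 0, 0, 0, 0, 0⟩, rfl⟩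
  | cons c w ih =>
    rcases ih with h | ⟨i, rfl⟩
    · exact Or.inl (h.cons c)
    · exact cons_word c i

end Words

/-! ### Linear independence -/

/-- Vectors with distinct leading words are linearly independent. -/
theorem linearIndependent_of_sub_single_mem {K ι : Type*} [Field K] {w : ι → Word}
    (hw : Function.Injective w) {T : ι → Word →₀ K}
    (hT : ∀ i, T i - Finsupp.single (w i) 1 ∈ Finsupp.supported K K {v | v ≺ w i}) :
    LinearIndependent K T := by
  have hval : ∀ i v, ¬ v ≺ w i → T i v = Finsupp.single (w i) (1 : K) v := fun i v hv => by
    rw [← sub_eq_zero, ← Finsupp.sub_apply]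
    by_contra h
    exact hv ((Finsupp.mem_supported K _).1 (hT i) (Finsupp.mem_support_iff.2 h))
  refine linearIndependent_iff'.2 fun s g hg => ?_
  by_contra! h
  obtain ⟨i, hi, hgi⟩ := h
  classical
  obtain ⟨i₀, hi₀, hmax⟩ := (s.filter fun i => g i ≠ 0).exists_max_image (fun i => key (w i))
    ⟨i, Finset.mem_filter.2 ⟨hi, hgi⟩⟩
  rw [Finset.mem_filter] at hi₀
  have hsum := DFunLike.congr_fun hg (w i₀)
  rw [Finsupp.finsetSum_apply, Finset.sum_eq_single i₀] at hsum
  · rw [Finsupp.smul_apply, hval _ _ (Prec.irrefl _)] at hsum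
    simp [hi₀.2] at hsum
  · intro j hj hji
    by_cases hgj : g j = 0
    · simp [hgj]
    · rw [Finsupp.smul_apply, hval _ _ (not_lt.2 (hmax j (Finset.mem_filter.2 ⟨hj, hgj⟩))),
        Finsupp.single_eq_of_ne fun h => hji (hw h).symm, smul_zero]
  · exact fun h => absurd hi₀.1 h

section PBW

variable {k} {q12 q13 q23} [CharZero k] (h12 : q12 ≠ 0) (h13 : q13 ≠ 0) (h23 : q23 ≠ 0)

theorem map_gen {A : Type*} [Ring A] [Algebra k A] (ψ : FreeAlgebra k (Fin 4) →ₐ[k] A)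
    {X : Fin 11 → A} (hX : ∀ p ∈ defPolys, eval (qVal h12 h13 h23) (evalWord X) p = 0)
    (h0 : ψ (x1 k) = X 0) (h1 : ψ (x3 k) = X 1) (h2 : ψ (y k) = X 2) (h10 : ψ (x2 k) = X 10)
    (c : Fin 11) : ψ (gen k q12 q13 q23 c) = X c := by
  simp only [defPolys, List.forall_mem_cons] at hX
  obtain ⟨e9, e8, e6, e7, e5, e4, e3, -⟩ := hX
  simp [qVal_val] at e9 e8 e6 e7 e5 e4 e3
  have h9 : ψ (z100 k q12) = X 9 := by
    rw [← sub_eq_zero, ← e9]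
    simp [z100, h2, h10]
    module
  have h8 : ψ (z010 k q12 q13 q23) = X 8 := by
    rw [← sub_eq_zero, ← e8]
    simp [z010, h1, h9]
    module
  have h6 : ψ (z110 k q12 q13 q23) = X 6 := by
    rw [← sub_eq_zero, ← e6]
    simp [z110, h2, h8]
    module
  have h7 : ψ (z001 k q12 q13 q23) = X 7 := by
    rw [← sub_eq_zero, ← e7]
    simp [z001, h0, h8]
    module
  have h5 : ψ (z101 k q12 q13 q23) = X 5 := by
    rw [← sub_eq_zero, ← e5]
    simp [z101, h2, h7]
    module
  have h4 : ψ (z011 k q12 q13 q23) = X 4 := by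
    rw [← sub_eq_zero, ← e4]
    simp [z011, h1, h5]
    module
  have h3 : ψ (z111 k q12 q13 q23) = X 3 := by
    rw [← sub_eq_zero, ← e3]
    simp [z111, h2, h4]
    module
  fin_cases c <;> assumption

theorem holds_leftMul_rules : ∀ r ∈ rules,
    Holds (qVal h12 h13 h23) (leftMul (qVal h12 h13 h23) rules) r := fun r hr =>
  holds_leftMul _ rules_prec rules_overlapsResolve hr (rules_ne_nil r hr).1 (rules_ne_nil r hr).2

/-- The action of the free algebra on the space spanned by the irreducible words. -/
def rep : FreeAlgebra k (Fin 4) →ₐ[k] Module.End k (Word →₀ k) :=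
  FreeAlgebra.lift k fun j => leftMul (qVal h12 h13 h23) rules (![0, 2, 10, 1] j)

theorem rep_gen (c : Fin 11) : rep h12 h13 h23 (gen k q12 q13 q23 c) =
    leftMul (qVal h12 h13 h23) rules c := by
  refine map_gen (A := Module.End k (Word →₀ k)) h12 h13 h23 _ (fun p hp => ?_) ?_ ?_ ?_ ?_ c
  · exact eval_eq_zero_of_holds (holds_leftMul_rules h12 h13 h23)
      (List.all_eq_true.1 defPolys_reduce p hp)
  all_goals simp [rep, x1, x2, x3, y]

theorem rep_rels {a : FreeAlgebra k (Fin 4)} (ha : a ∈ rels k q12 q13 q23) :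
    rep h12 h13 h23 a = 0 := by
  rw [rels_eq h12 h13 h23, Set.mem_ofPred_eq, List.mem_map] at ha
  obtain ⟨p, hp, rfl⟩ := ha
  rw [map_eval_gen (A := Module.End k (Word →₀ k)) (rep_gen h12 h13 h23)]
  exact eval_eq_zero_of_holds (holds_leftMul_rules h12 h13 h23)
    (List.all_eq_true.1 relPolys_reduce p hp)

include h12 h13 h23 in
theorem linearIndependent_mon : LinearIndependent k (mon k q12 q13 q23) := by
  let Ψ : RingQuot (rel k q12 q13 q23) →ₐ[k] Module.End k (Word →₀ k) :=
    RingQuot.liftAlgHom k ⟨rep h12 h13 h23, fun a b h => by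
      rw [rep_rels h12 h13 h23 h.1, h.2, map_zero]⟩
  let f : RingQuot (rel k q12 q13 q23) →ₗ[k] Word →₀ k :=
    LinearMap.applyₗ (nf (qVal h12 h13 h23) rules []) ∘ₗ Ψ.toLinearMap
  refine LinearIndependent.of_comp f (linearIndependent_of_sub_single_mem word_injective fun i => ?_)
  have hi : f (mon k q12 q13 q23 i) =
      rep h12 h13 h23 (freeMon k q12 q13 q23 i) (nf (qVal h12 h13 h23) rules []) := by
    simp only [f, Ψ, mon, LinearMap.comp_apply, AlgHom.toLinearMap_apply,
      RingQuot.liftAlgHom_mkAlgHom_apply, freeMon, LinearMap.applyₗ_apply_apply]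
  have hlead := isLead_map_freeMon (A := Module.End k (Word →₀ k)) h12 h13 h23 (rep h12 h13 h23) i
  have hnf (v : Word) : evalWord (leftMul (qVal h12 h13 h23) rules) v
      (nf (qVal h12 h13 h23) rules []) = nf (qVal h12 h13 h23) rules v := by
    rw [evalWord_leftMul_nf _ rules_prec rules_overlapsResolve, List.append_nil]
  simp only [IsLead, rep_gen] at hlead
  have hle : below (K := k) (leftMul (qVal h12 h13 h23) rules) i.word ≤
      (Finsupp.supported k k {v | v ≺ i.word}).comap
        (LinearMap.applyₗ (nf (qVal h12 h13 h23) rules [])) := by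
    refine Submodule.span_le.2 ?_
    rintro _ ⟨v, hv, rfl⟩
    rw [SetLike.mem_coe, Submodule.mem_comap, LinearMap.applyₗ_apply_apply, hnf]
    refine Finsupp.supported_mono ?_ (nf_mem_supported _ rules_prec v)
    rintro u (rfl | hu)
    · exact hv
    · exact Prec.trans hu hv
  have h := hle hlead
  rw [Submodule.mem_comap, LinearMap.applyₗ_apply_apply, LinearMap.sub_apply, hnf,
    nf_of_not_reducible _ (word_not_reducible i)] at h
  rwa [Function.comp_apply, hi]

/-! ### Spanning -/

include h12 h13 h23 in
theorem holds_mkAlgHom : ∀ r ∈ rules, Holds (qVal h12 h13 h23)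
    (fun c => RingQuot.mkAlgHom k (rel k q12 q13 q23) (gen k q12 q13 q23 c)) r := by
  have hbase : ∀ p ∈ relPolys ++ defPolys, eval (qVal h12 h13 h23)
      (evalWord fun c => RingQuot.mkAlgHom k (rel k q12 q13 q23) (gen k q12 q13 q23 c)) p = 0 := by
    intro p hp
    rw [← map_eval_gen fun _ => rfl]
    rcases List.mem_append.1 hp with hp | hp
    · rw [RingQuot.mkAlgHom_rel k (s := rel k q12 q13 q23) (y := 0), map_zero]
      refine ⟨?_, rfl⟩
      rw [rels_eq h12 h13 h23]
      exact List.mem_map_of_mem hp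
    · rw [eval_defPolys h12 h13 h23 p hp, map_zero]
  intro r hr
  obtain ⟨d, hd, rfl⟩ := List.mem_map.1 hr
  exact holds_of_derivable hbase (by simp) rules_derivable d hd

include h12 h13 h23 in
theorem evalWord_mem_span_mon (w : Word) :
    evalWord (fun c => RingQuot.mkAlgHom k (rel k q12 q13 q23) (gen k q12 q13 q23 c)) w ∈
      Submodule.span k (Set.range (mon k q12 q13 q23)) := by
  induction w using prec_wf.induction with
  | _ w ih =>
    rcases reducible_or_eq_word w with ⟨r, hr, a, b, rfl⟩ | ⟨i, rfl⟩
    · rw [evalWord_append, evalWord_append, holds_mkAlgHom h12 h13 h23 r hr,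
        ← eval_evalWord_append]
      exact eval_mem _ fun t ht => ih _ ((rules_prec r hr t ht).append a b)
    · have hlead := isLead_map_freeMon h12 h13 h23
        (RingQuot.mkAlgHom k (rel k q12 q13 q23)) i
      have hle : below (K := k) (fun c => RingQuot.mkAlgHom k (rel k q12 q13 q23)
          (gen k q12 q13 q23 c)) i.word ≤ Submodule.span k (Set.range (mon k q12 q13 q23)) := by
        refine Submodule.span_le.2 ?_
        rintro _ ⟨v, hv, rfl⟩
        exact ih v hv
      exact (Submodule.sub_mem_iff_right _
        (Submodule.subset_span (Set.mem_range_self (f := mon k q12 q13 q23) i))).1 (hle hlead)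

include h12 h13 h23 in
theorem span_mon : Submodule.span k (Set.range (mon k q12 q13 q23)) = ⊤ := by
  have hword (a : FreeAlgebra k (Fin 4)) :
      a ∈ Submodule.span k (Set.range (evalWord (gen k q12 q13 q23))) := by
    have hgen (c : Fin 11) :
        gen k q12 q13 q23 c ∈ Submodule.span k (Set.range (evalWord (gen k q12 q13 q23))) :=
      Submodule.subset_span ⟨[c], by simp⟩
    induction a with
    | grade0 c =>
      rw [Algebra.algebraMap_eq_smul_one]
      exact Submodule.smul_mem _ c (Submodule.subset_span ⟨[], rfl⟩)
    | grade1 j => fin_cases j <;> [exact hgen 0; exact hgen 2; exact hgen 10; exact hgen 1]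
    | add a b ha hb => exact Submodule.add_mem _ ha hb
    | mul a b ha hb =>
      have h := Submodule.mul_mem_mul ha hb
      rw [Submodule.span_mul_span] at h
      refine Submodule.span_mono ?_ h
      rintro _ ⟨_, ⟨v, rfl⟩, _, ⟨w, rfl⟩, rfl⟩
      exact ⟨v ++ w, evalWord_append _ v w⟩
  have hle : Submodule.span k (Set.range (evalWord (gen k q12 q13 q23))) ≤
      (Submodule.span k (Set.range (mon k q12 q13 q23))).comap
        (RingQuot.mkAlgHom k (rel k q12 q13 q23)).toLinearMap := by
    refine Submodule.span_le.2 ?_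
    rintro _ ⟨w, rfl⟩
    rw [SetLike.mem_coe, Submodule.mem_comap, AlgHom.toLinearMap_apply, map_evalWord]
    exact evalWord_mem_span_mon h12 h13 h23 w
  rw [eq_top_iff]
  rintro x -
  obtain ⟨a, rfl⟩ := RingQuot.mkAlgHom_surjective k (rel k q12 q13 q23) x
  exact hle (hword a)

end PBW

theorem statement10 [IsAlgClosed k] [CharZero k]
    (h12 : q12 ≠ 0) (h13 : q13 ≠ 0) (h23 : q23 ≠ 0) :
    LinearIndependent k (mon k q12 q13 q23) ∧
      Submodule.span k (Set.range (mon k q12 q13 q23)) = ⊤ := by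
  exact ⟨linearIndependent_mon h12 h13 h23, span_mon h12 h13 h23⟩

end Stmt10
end
end

section
/- Let A be any associative k-algebra containing elements x1,y,x2,x3 that satisfy the relations: y·x1 + x1·y = 0; y² = 0; s² = 0; r² = 0; r·x3 + q13²·x3·r = 0; x3² = 0; x13² = 0; x1² = 0; x2·x3 = q23·x3·x2; x1·x2 = q12·x2·x1; z100·x2 = q12·x2·z100. Then for all ℓ,m,n ∈ {0,1} the following identities hold in A: (i) x1·z_{ℓmn} − (−1)^{ℓ+m}·q12·q13^{m+n}·z_{ℓmn}·x1 = δ_{m,1}·δ_{n,0}·(−1)^{ℓ}·z_{ℓ01}; (ii) y·z_{ℓmn} − (−1)^{ℓ+m}·q12·q13^{m+n}·z_{ℓmn}·y = δ_{ℓ,0}·z_{1mn}; (iii) x3·z_{ℓmn} − (−1)^{m+n}·(−q13⁻¹)^{ℓ+m+2n}·q23⁻¹·z_{ℓmn}·x3 = δ_{ℓ,1}·δ_{m,0}·z_{01n}. Here δ denotes the Kronecker delta. -/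
/-- The braided adjoint action of `x` on `z`, where `c` is the scalar braiding `x` past `z`. -/
def braidedAd {k A : Type*} [CommRing k] [Ring A] [Algebra k A] (c : k) (x z : A) : A :=
  x * z - c • (z * x)

section BraidedAd

variable {k A : Type*} [CommRing k] [Ring A] [Algebra k A]

theorem braidedAd_zero_left (c : k) (z : A) : braidedAd c 0 z = 0 := by
  simp [braidedAd]

theorem braidedAd_zero_right (c : k) (x : A) : braidedAd c x 0 = 0 := by
  simp [braidedAd]

/-- A braided commutator of `x` and `y` acts on an element annihilated by `x` as `x` after `y`. -/
theorem braidedAd_braidedAd {c c' d e μ : k} {x y z : A} (h : braidedAd c x z = 0)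
    (hc : c' = -μ * c) (he : e = c * d) :
    braidedAd c' x (braidedAd d y z) = braidedAd e (x * y + μ • (y * x)) z := by
  subst hc he
  have hxz : x * z = c • (z * x) := sub_eq_zero.mp h
  have h₁ : x * (z * y) = c • (z * (x * y)) := by
    rw [← mul_assoc, hxz, smul_mul_assoc, mul_assoc]
  have h₂ : y * (z * x) = y * z * x := (mul_assoc _ _ _).symm
  simp only [braidedAd, mul_sub, sub_mul, mul_add, add_mul, mul_smul_comm, smul_mul_assoc,
    mul_assoc, h₁, hxz]
  module

/-- An element squaring to zero acts with square zero. -/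
theorem braidedAd_self_braidedAd {c c' : k} {x : A} (z : A) (hx : x ^ 2 = 0) (hc : c' = -c) :
    braidedAd c' x (braidedAd c x z) = 0 := by
  subst hc
  have h₁ : x * (x * z) = 0 := by rw [← mul_assoc, ← pow_two, hx, zero_mul]
  have h₂ : z * (x * x) = 0 := by rw [← pow_two, hx, mul_zero]
  simp only [braidedAd, mul_sub, sub_mul, mul_smul_comm, smul_mul_assoc, mul_assoc, h₁, h₂]
  module

/-- The actions of anticommuting elements anticommute. -/
theorem braidedAd_braidedAd_of_anticomm {c c' d d' : k} {x y : A} (z : A)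
    (h : y * x + x * y = 0) (hc : c' = -c) (hd : d' = -d) :
    braidedAd c' x (braidedAd d y z) = -braidedAd d' y (braidedAd c x z) := by
  subst hc hd
  have hyx : y * x = -(x * y) := eq_neg_of_add_eq_zero_left h
  have h₁ : y * (x * z) = -(x * (y * z)) := by rw [← mul_assoc, hyx, neg_mul, mul_assoc]
  simp only [braidedAd, mul_sub, sub_mul, mul_smul_comm, smul_mul_assoc, mul_assoc, h₁, hyx,
    mul_neg]
  module

end BraidedAd

theorem statement12 {k A : Type*} [Field k] [IsAlgClosed k] [CharZero k]
    [Ring A] [Algebra k A]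
    (q12 q13 q23 : k) (h12 : q12 ≠ 0) (h13 : q13 ≠ 0) (h23 : q23 ≠ 0)
    (x1 y x2 x3 x13 s r : A) (zf : Fin 2 → Fin 2 → Fin 2 → A)
    (hx13 : x13 = x1 * x3 - q13 • (x3 * x1))
    (hs : s = x3 * y + q13⁻¹ • (y * x3))
    (hr : r = x1 * s + q13 • (s * x1))
    (h000 : zf 0 0 0 = x2)
    (h100 : zf 1 0 0 = y * x2 - q12 • (x2 * y))
    (h010 : zf 0 1 0 = x3 * zf 1 0 0 + (q13⁻¹ * q23⁻¹) • (zf 1 0 0 * x3))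
    (h110 : zf 1 1 0 = y * zf 0 1 0 + (q12 * q13) • (zf 0 1 0 * y))
    (h001 : zf 0 0 1 = x1 * zf 0 1 0 + (q12 * q13) • (zf 0 1 0 * x1))
    (h101 : zf 1 0 1 = y * zf 0 0 1 - (q12 * q13) • (zf 0 0 1 * y))
    (h011 : zf 0 1 1 = x3 * zf 1 0 1 - ((q13 ^ 3)⁻¹ * q23⁻¹) • (zf 1 0 1 * x3))
    (h111 : zf 1 1 1 = y * zf 0 1 1 + (q12 * q13 ^ 2) • (zf 0 1 1 * y))
    (r1 : y * x1 + x1 * y = 0) (r2 : y ^ 2 = 0) (r3 : s ^ 2 = 0) (r4 : r ^ 2 = 0)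
    (r5 : r * x3 + (q13 ^ 2) • (x3 * r) = 0)
    (r6 : x3 ^ 2 = 0) (r7 : x13 ^ 2 = 0) (r8 : x1 ^ 2 = 0)
    (r9 : x2 * x3 = q23 • (x3 * x2))
    (r10 : x1 * x2 = q12 • (x2 * x1))
    (r11 : zf 1 0 0 * x2 = q12 • (x2 * zf 1 0 0)) :
    ∀ ℓ m n : Fin 2,
      (x1 * zf ℓ m n
          - ((-1 : k) ^ ((ℓ : ℕ) + (m : ℕ)) * q12 * q13 ^ ((m : ℕ) + (n : ℕ))) •
            (zf ℓ m n * x1)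
        = if m = 1 ∧ n = 0 then ((-1 : k) ^ (ℓ : ℕ)) • zf ℓ 0 1 else 0) ∧
      (y * zf ℓ m n
          - ((-1 : k) ^ ((ℓ : ℕ) + (m : ℕ)) * q12 * q13 ^ ((m : ℕ) + (n : ℕ))) •
            (zf ℓ m n * y)
        = if ℓ = 0 then zf 1 m n else 0) ∧
      (x3 * zf ℓ m n
          - ((-1 : k) ^ ((m : ℕ) + (n : ℕ)) * (-q13⁻¹) ^ ((ℓ : ℕ) + (m : ℕ) + 2 * (n : ℕ))
              * q23⁻¹) • (zf ℓ m n * x3)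
        = if ℓ = 1 ∧ m = 0 then zf 0 1 n else 0) := by
  obtain ⟨p, hp⟩ : ∃ p, p = q13⁻¹ := ⟨_, rfl⟩
  obtain ⟨b, hb⟩ : ∃ b, b = q23⁻¹ := ⟨_, rfl⟩
  have hpq : q13 * p = 1 := by rw [hp, mul_inv_cancel₀ h13]
  -- the nontrivial actions, which define the elements `zf ℓ m n`
  have y000 : braidedAd q12 y (zf 0 0 0) = zf 1 0 0 := by rw [h100, h000, braidedAd]
  have t100 : braidedAd (-(p * b)) x3 (zf 1 0 0) = zf 0 1 0 := by
    rw [h010, braidedAd, neg_smul, sub_neg_eq_add, hp, hb]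
  have y010 : braidedAd (-(q12 * q13)) y (zf 0 1 0) = zf 1 1 0 := by
    rw [h110, braidedAd, neg_smul, sub_neg_eq_add]
  have x010 : braidedAd (-(q12 * q13)) x1 (zf 0 1 0) = zf 0 0 1 := by
    rw [h001, braidedAd, neg_smul, sub_neg_eq_add]
  have y001 : braidedAd (q12 * q13) y (zf 0 0 1) = zf 1 0 1 := by rw [h101, braidedAd]
  have t101 : braidedAd (p ^ 3 * b) x3 (zf 1 0 1) = zf 0 1 1 := by
    rw [h011, braidedAd, hp, hb, inv_pow]
  have y011 : braidedAd (-(q12 * q13 ^ 2)) y (zf 0 1 1) = zf 1 1 1 := by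
    rw [h111, braidedAd, neg_smul, sub_neg_eq_add]
  -- `x1` and `x3` annihilate `zf 0 0 0`
  have x000 : braidedAd q12 x1 (zf 0 0 0) = 0 := by rw [h000, braidedAd, r10, sub_self]
  have t000 : braidedAd b x3 (zf 0 0 0) = 0 := by
    rw [h000, braidedAd, r9, hb, inv_smul_smul₀ h23, sub_self]
  -- vanishing because `x1`, `y`, `x3` square to zero
  have y100 : braidedAd (-q12) y (zf 1 0 0) = 0 := by
    rw [← y000]; exact braidedAd_self_braidedAd _ r2 rfl
  have y110 : braidedAd (q12 * q13) y (zf 1 1 0) = 0 := by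
    rw [← y010]; exact braidedAd_self_braidedAd _ r2 (by ring)
  have y101 : braidedAd (-(q12 * q13)) y (zf 1 0 1) = 0 := by
    rw [← y001]; exact braidedAd_self_braidedAd _ r2 rfl
  have y111 : braidedAd (q12 * q13 ^ 2) y (zf 1 1 1) = 0 := by
    rw [← y011]; exact braidedAd_self_braidedAd _ r2 (by ring)
  have t010 : braidedAd (p * b) x3 (zf 0 1 0) = 0 := by
    rw [← t100]; exact braidedAd_self_braidedAd _ r6 (by ring)
  have t011 : braidedAd (-(p ^ 3 * b)) x3 (zf 0 1 1) = 0 := by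
    rw [← t101]; exact braidedAd_self_braidedAd _ r6 rfl
  have x001 : braidedAd (q12 * q13) x1 (zf 0 0 1) = 0 := by
    rw [← x010]; exact braidedAd_self_braidedAd _ r8 (by ring)
  -- moving `x1` past `y`
  have x100 : braidedAd (-q12) x1 (zf 1 0 0) = 0 := by
    rw [← y000, braidedAd_braidedAd_of_anticomm _ r1 rfl rfl, x000, braidedAd_zero_right, neg_zero]
  have x110 : braidedAd (q12 * q13) x1 (zf 1 1 0) = -zf 1 0 1 := by
    rw [← y010, braidedAd_braidedAd_of_anticomm _ r1 (neg_neg _).symm (neg_neg _).symm, x010, y001]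
  have x101 : braidedAd (-(q12 * q13)) x1 (zf 1 0 1) = 0 := by
    rw [← y001, braidedAd_braidedAd_of_anticomm _ r1 rfl rfl, x001, braidedAd_zero_right, neg_zero]
  -- the action of `s` on elements annihilated by `x3`
  rw [← hp] at hs
  have s000 : braidedAd (q12 * b) s (zf 0 0 0) = zf 0 1 0 := by
    rw [hs, ← braidedAd_braidedAd t000 (c' := -(p * b)) (d := q12) (by ring) (by ring), y000, t100]
  have t110 : braidedAd (-(p ^ 2 * b)) x3 (zf 1 1 0) = 0 := by
    rw [← y010, braidedAd_braidedAd t010 (e := -(q12 * b)) (μ := p) (by ring)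
      (by linear_combination q12 * b * hpq), ← hs, ← s000]
    exact braidedAd_self_braidedAd _ r3 rfl
  -- the action of `r`
  have r000 : braidedAd (q12 ^ 2 * b) r (zf 0 0 0) = zf 0 0 1 := by
    rw [hr, ← braidedAd_braidedAd x000 (c' := -(q12 * q13)) (d := q12 * b) (by ring) (by ring),
      s000, x010]
  have t001 : braidedAd (-(p ^ 2 * b)) x3 (zf 0 0 1) = 0 := by
    have hx3r : x3 * r + p ^ 2 • (r * x3) = 0 := by
      have hpq2 : p ^ 2 * q13 ^ 2 = 1 := by rw [← mul_pow, mul_comm p, hpq, one_pow]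
      rw [eq_neg_of_add_eq_zero_left r5, smul_neg, smul_smul, hpq2, one_smul, add_neg_cancel]
    rw [← r000, braidedAd_braidedAd t000 (μ := p ^ 2) (by ring) rfl, hx3r, braidedAd_zero_left]
  have s001 : braidedAd (-(q12 * p * b)) s (zf 0 0 1) = zf 0 1 1 := by
    rw [hs, ← braidedAd_braidedAd t001 (c' := p ^ 3 * b) (d := q12 * q13) (by ring)
      (by linear_combination q12 * p * b * hpq), y001, t101]
  have x011 : braidedAd (-(q12 * q13 ^ 2)) x1 (zf 0 1 1) = 0 := by
    rw [← s001, braidedAd_braidedAd x001 (e := -(q12 ^ 2 * b)) (μ := q13) (by ring)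
      (by linear_combination q12 ^ 2 * b * hpq), ← hr, ← r000]
    exact braidedAd_self_braidedAd _ r4 rfl
  have x111 : braidedAd (q12 * q13 ^ 2) x1 (zf 1 1 1) = 0 := by
    rw [← y011, braidedAd_braidedAd_of_anticomm _ r1 (neg_neg _).symm (neg_neg _).symm, x011,
      braidedAd_zero_right, neg_zero]
  have t111 : braidedAd (p ^ 4 * b) x3 (zf 1 1 1) = 0 := by
    rw [← y011, braidedAd_braidedAd t011 (e := q12 * p * b) (μ := p) (by ring)
      (by linear_combination (-q12 * p * b * (q13 * p + 1)) * hpq), ← hs, ← s001]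
    exact braidedAd_self_braidedAd _ r3 (neg_neg _).symm
  have of_ad {c c' : k} {x z w w' : A} (h : braidedAd c x z = w) (hc : c' = c) (hw : w' = w) :
      x * z - c' • (z * x) = w' := by rw [hc, hw, ← h, braidedAd]
  rw [← hp, ← hb]
  simp only [Fin.forall_fin_two]
  refine ⟨⟨⟨⟨of_ad x000 ?_ ?_, of_ad y000 ?_ ?_, of_ad t000 ?_ ?_⟩,
    ⟨of_ad x001 ?_ ?_, of_ad y001 ?_ ?_, of_ad t001 ?_ ?_⟩⟩,
    ⟨of_ad x010 ?_ ?_, of_ad y010 ?_ ?_, of_ad t010 ?_ ?_⟩,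
    ⟨of_ad x011 ?_ ?_, of_ad y011 ?_ ?_, of_ad t011 ?_ ?_⟩⟩,
    ⟨⟨of_ad x100 ?_ ?_, of_ad y100 ?_ ?_, of_ad t100 ?_ ?_⟩,
    ⟨of_ad x101 ?_ ?_, of_ad y101 ?_ ?_, of_ad t101 ?_ ?_⟩⟩,
    ⟨of_ad x110 ?_ ?_, of_ad y110 ?_ ?_, of_ad t110 ?_ ?_⟩,
    ⟨of_ad x111 ?_ ?_, of_ad y111 ?_ ?_, of_ad t111 ?_ ?_⟩⟩
  all_goals first | (simp; done) | (simp [-mul_eq_mul_right_iff]; ring)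
end

section
/- Let B be the quotient of the free associative algebra k⟨x1,y,x2,u⟩ by the two-sided ideal generated by: x1², y², x2², u²; x1·y + y·x1; x2·u + u·x2; x2·x1 − q⁻¹·x1·x2; x2·z + q⁻¹·z·x2; x1·s + q·s·x1; x1·u − q·(u+x2)·x1 − z; t·x2 + q·x2·t; t·u + q·u·t + q·x2·t; t·z − z·t + z². Then the images in B of the monomials u^{m1}·t^{m2}·x2^{m3}·z^{m4}·y^{m5}·x1^{m6}, where m1,m3,m5,m6 ∈ {0,1} and m2,m4 ∈ ℕ, form a k-vector space basis of B. -/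
/- Statement 13: PBW basis of the Nichols algebra 𝔅(𝔖_{2,0}(q)) (Theorem 6.2 of the paper). -/

noncomputable section
namespace Stmt13

variable (k : Type*) [Field k] (q : k)

def x1 : FreeAlgebra k (Fin 4) := FreeAlgebra.ι k 0
/-- `y` stands for the generator x_{3/2} of the paper. -/
def y : FreeAlgebra k (Fin 4) := FreeAlgebra.ι k 1
def x2 : FreeAlgebra k (Fin 4) := FreeAlgebra.ι k 2
/-- `u` stands for the generator x_{5/2} of the paper. -/
def u : FreeAlgebra k (Fin 4) := FreeAlgebra.ι k 3

/-- z := y·x2 − q·x2·y (the element x_{3/2 2}) -/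
def z : FreeAlgebra k (Fin 4) := y k * x2 k - q • (x2 k * y k)
/-- s := u·x1 − q⁻¹·x1·u (the element x_{5/2 1}) -/
def s : FreeAlgebra k (Fin 4) := u k * x1 k - q⁻¹ • (x1 k * u k)
/-- t := y·u − q·(u+x2)·y (the element x_{3/2 5/2}) -/
def t : FreeAlgebra k (Fin 4) := y k * u k - q • ((u k + x2 k) * y k)

def rels : Set (FreeAlgebra k (Fin 4)) :=
  { x1 k ^ 2, y k ^ 2, x2 k ^ 2, u k ^ 2,
    x1 k * y k + y k * x1 k,
    x2 k * u k + u k * x2 k,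
    x2 k * x1 k - q⁻¹ • (x1 k * x2 k),
    x2 k * z k q + q⁻¹ • (z k q * x2 k),
    x1 k * s k q + q • (s k q * x1 k),
    x1 k * u k - q • ((u k + x2 k) * x1 k) - z k q,
    t k q * x2 k + q • (x2 k * t k q),
    t k q * u k + q • (u k * t k q) + q • (x2 k * t k q),
    t k q * z k q - z k q * t k q + z k q ^ 2 }

def rel (a b : FreeAlgebra k (Fin 4)) : Prop := a ∈ rels k q ∧ b = 0

/-- The index set of the PBW monomials. -/
structure Idx where
  m1 : Fin 2
  m2 : ℕ
  m3 : Fin 2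
  m4 : ℕ
  m5 : Fin 2
  m6 : Fin 2

/-- The PBW monomials u^{m1}·t^{m2}·x2^{m3}·z^{m4}·y^{m5}·x1^{m6}. -/
def mon (i : Idx) : RingQuot (rel k q) :=
  RingQuot.mkAlgHom k (rel k q)
    (u k ^ (i.m1 : ℕ) * t k q ^ i.m2 * x2 k ^ (i.m3 : ℕ) * z k q ^ i.m4 *
      y k ^ (i.m5 : ℕ) * x1 k ^ (i.m6 : ℕ))

section Representation

variable {k}

/-- The PBW monomials should form a basis, so a functional is a function `f : Idx → k`.
This is `f ↦ f (e * u * y^c * x1^d)` as a function of the monomial `e * y^c * x1^d`, where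
`e = u^a t^n x2^b z^m`; similarly for `coreX2`, `coreT` and `coreZ`. -/
def coreU (f : Idx → k) : Idx → k
  | ⟨0, n, 0, m, c, d⟩ =>
      (-q) ^ m * ((-q) ^ n * f ⟨1, n, 0, m, c, d⟩ + (n + m) * f ⟨0, n, 1, m, c, d⟩)
  | ⟨1, n, 0, m, c, d⟩ => (-q) ^ m * ((n + m) * f ⟨1, n, 1, m, c, d⟩)
  | ⟨0, n, 1, m, c, d⟩ => -((-q) ^ m * (-q) ^ n * f ⟨1, n, 1, m, c, d⟩)
  | ⟨1, _, 1, _, _, _⟩ => 0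

def coreX2 (f : Idx → k) : Idx → k
  | ⟨a, n, 0, m, c, d⟩ => (-q) ^ m * f ⟨a, n, 1, m, c, d⟩
  | ⟨_, _, 1, _, _, _⟩ => 0

def coreT (f : Idx → k) : Idx → k
  | ⟨a, n, 0, m, c, d⟩ => f ⟨a, n + 1, 0, m, c, d⟩ + m * f ⟨a, n, 0, m + 1, c, d⟩
  | ⟨a, n, 1, m, c, d⟩ => (-q)⁻¹ * f ⟨a, n + 1, 1, m, c, d⟩ + m * f ⟨a, n, 1, m + 1, c, d⟩

def coreZ (f : Idx → k) : Idx → k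
  | ⟨a, n, b, m, c, d⟩ => f ⟨a, n, b, m + 1, c, d⟩

/-- `f ↦ f (e * x1)` as a function of the PBW monomial `e`; similarly for `actY`, `actX2`, `actZ`,
`actT` and `actU`. -/
def actX1 (f : Idx → k) : Idx → k
  | ⟨a, n, b, m, c, 0⟩ => f ⟨a, n, b, m, c, 1⟩
  | ⟨_, _, _, _, _, 1⟩ => 0

def actY (f : Idx → k) : Idx → k
  | ⟨a, n, b, m, 0, 0⟩ => f ⟨a, n, b, m, 1, 0⟩
  | ⟨a, n, b, m, 0, 1⟩ => -f ⟨a, n, b, m, 1, 1⟩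
  | ⟨_, _, _, _, 1, _⟩ => 0

def actX2 (f : Idx → k) : Idx → k
  | ⟨a, n, b, m, 0, 0⟩ => coreX2 q f ⟨a, n, b, m, 0, 0⟩
  | ⟨a, n, b, m, 0, 1⟩ => q * coreX2 q f ⟨a, n, b, m, 0, 1⟩
  | ⟨a, n, b, m, 1, 0⟩ => coreZ f ⟨a, n, b, m, 0, 0⟩ + q * coreX2 q f ⟨a, n, b, m, 1, 0⟩
  | ⟨a, n, b, m, 1, 1⟩ =>
      q * (coreZ f ⟨a, n, b, m, 0, 1⟩ + q * coreX2 q f ⟨a, n, b, m, 1, 1⟩)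

def actZ (f : Idx → k) : Idx → k
  | ⟨a, n, b, m, 0, 0⟩ => coreZ f ⟨a, n, b, m, 0, 0⟩
  | ⟨a, n, b, m, 0, 1⟩ => -q * coreZ f ⟨a, n, b, m, 0, 1⟩
  | ⟨a, n, b, m, 1, 0⟩ => -q * coreZ f ⟨a, n, b, m, 1, 0⟩
  | ⟨a, n, b, m, 1, 1⟩ => q ^ 2 * coreZ f ⟨a, n, b, m, 1, 1⟩

def actT (f : Idx → k) : Idx → k
  | ⟨a, n, b, m, 0, 0⟩ => coreT q f ⟨a, n, b, m, 0, 0⟩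
  | ⟨a, n, b, m, 0, 1⟩ => -q * (coreT q f ⟨a, n, b, m, 0, 1⟩ + coreZ f ⟨a, n, b, m, 0, 1⟩)
  | ⟨a, n, b, m, 1, 0⟩ => -q * (coreT q f ⟨a, n, b, m, 1, 0⟩ + coreZ f ⟨a, n, b, m, 1, 0⟩)
  | ⟨a, n, b, m, 1, 1⟩ =>
      q ^ 2 * (coreT q f ⟨a, n, b, m, 1, 1⟩ + 2 * coreZ f ⟨a, n, b, m, 1, 1⟩)

def actU (f : Idx → k) : Idx → k
  | ⟨a, n, b, m, 0, 0⟩ => coreU q f ⟨a, n, b, m, 0, 0⟩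
  | ⟨a, n, b, m, 0, 1⟩ =>
      q * coreU q f ⟨a, n, b, m, 0, 1⟩ + q * coreX2 q f ⟨a, n, b, m, 0, 1⟩ +
        coreZ f ⟨a, n, b, m, 0, 0⟩
  | ⟨a, n, b, m, 1, 0⟩ =>
      coreT q f ⟨a, n, b, m, 0, 0⟩ + q * coreU q f ⟨a, n, b, m, 1, 0⟩ +
        q * coreX2 q f ⟨a, n, b, m, 1, 0⟩
  | ⟨a, n, b, m, 1, 1⟩ =>
      q * coreT q f ⟨a, n, b, m, 0, 1⟩ + q * coreZ f ⟨a, n, b, m, 0, 1⟩ -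
        q * coreZ f ⟨a, n, b, m, 1, 0⟩ + q ^ 2 * coreU q f ⟨a, n, b, m, 1, 1⟩ +
        2 * q ^ 2 * coreX2 q f ⟨a, n, b, m, 1, 1⟩

theorem forall_idx {P : Idx → Prop}
    (h : ∀ (a b c d : Fin 2) (n m : ℕ), P ⟨a, n, b, m, c, d⟩) (i : Idx) : P i :=
  h i.m1 i.m3 i.m5 i.m6 i.m2 i.m4

/-- Right multiplication by `x1` on the span of the monomials, acting on functionals. -/
def opX1 : Module.End k (Idx → k) where
  toFun := actX1
  map_add' f g := funext <| forall_idx <| by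
    simp [Fin.forall_fin_two, actX1]
  map_smul' r f := funext <| forall_idx <| by
    simp [Fin.forall_fin_two, actX1]

def opY : Module.End k (Idx → k) where
  toFun := actY
  map_add' f g := funext <| forall_idx <| by
    simp [Fin.forall_fin_two, actY, add_comm]
  map_smul' r f := funext <| forall_idx <| by
    simp [Fin.forall_fin_two, actY]

def opX2 : Module.End k (Idx → k) where
  toFun := actX2 q
  map_add' f g := funext <| forall_idx <| by
    simp only [Fin.forall_fin_two, actX2, coreX2, coreZ, Pi.add_apply]
    and_intros <;> intros <;> ring
  map_smul' r f := funext <| forall_idx <| by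
    simp only [Fin.forall_fin_two, actX2, coreX2, coreZ, Pi.smul_apply, smul_eq_mul,
      RingHom.id_apply]
    and_intros <;> intros <;> ring

def opU : Module.End k (Idx → k) where
  toFun := actU q
  map_add' f g := funext <| forall_idx <| by
    simp only [Fin.forall_fin_two, actU, coreU, coreT, coreX2, coreZ, Pi.add_apply]
    and_intros <;> intros <;> ring
  map_smul' r f := funext <| forall_idx <| by
    simp only [Fin.forall_fin_two, actU, coreU, coreT, coreX2, coreZ, Pi.smul_apply, smul_eq_mul,
      RingHom.id_apply]
    and_intros <;> intros <;> ring

/-- The action of the free algebra on functionals by `(a • f) e = f (e * a)`. -/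
def freeRep : FreeAlgebra k (Fin 4) →ₐ[k] Module.End k (Idx → k) :=
  FreeAlgebra.lift k ![opX1, opY, opX2 q, opU q]

theorem freeRep_x1 (f : Idx → k) : freeRep q (x1 k) f = actX1 f := by
  simp [freeRep, x1, opX1]

theorem freeRep_y (f : Idx → k) : freeRep q (y k) f = actY f := by
  simp [freeRep, y, opY]

theorem freeRep_x2 (f : Idx → k) : freeRep q (x2 k) f = actX2 q f := by
  simp [freeRep, x2, opX2]

theorem freeRep_u (f : Idx → k) : freeRep q (u k) f = actU q f := by
  simp [freeRep, u, opU]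

theorem freeRep_z (f : Idx → k) : freeRep q (z k q) f = actZ q f := by
  simp only [z, map_sub, map_smul, map_mul, LinearMap.sub_apply, LinearMap.smul_apply,
    Module.End.mul_apply, freeRep_x2, freeRep_y]
  refine funext <| forall_idx ?_
  simp only [Fin.forall_fin_two, actY, actX2, actZ, coreX2, coreZ, Pi.sub_apply, Pi.smul_apply,
    smul_eq_mul]
  and_intros <;> intros <;> ring

theorem freeRep_t (f : Idx → k) : freeRep q (t k q) f = actT q f := by
  simp only [t, map_sub, map_smul, map_mul, map_add, LinearMap.sub_apply, LinearMap.smul_apply,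
    LinearMap.add_apply, Module.End.mul_apply, freeRep_x2, freeRep_y, freeRep_u]
  refine funext <| forall_idx ?_
  simp only [Fin.forall_fin_two, actY, actX2, actU, actT, coreU, coreT, coreX2, coreZ,
    Pi.sub_apply, Pi.add_apply, Pi.smul_apply, smul_eq_mul]
  and_intros <;> intros <;> ring

variable {q}

set_option maxHeartbeats 4000000 in
theorem freeRep_rels (hq : q ≠ 0) {a : FreeAlgebra k (Fin 4)} (ha : a ∈ rels k q) :
    freeRep q a = 0 := by
  refine LinearMap.ext fun f => funext <| forall_idx ?_
  simp only [rels, Set.mem_insert_iff, Set.mem_singleton_iff] at ha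
  rcases ha with rfl | rfl | rfl | rfl | rfl | rfl | rfl | rfl | rfl | rfl | rfl | rfl | rfl <;>
  · simp only [s, pow_two, map_sub, map_smul, map_mul, map_add, LinearMap.sub_apply,
      LinearMap.smul_apply, LinearMap.add_apply, LinearMap.zero_apply, Module.End.mul_apply,
      freeRep_x1, freeRep_x2, freeRep_y, freeRep_u, freeRep_z, freeRep_t, Fin.forall_fin_two,
      actX1, actY, actX2, actU, actZ, actT, coreU, coreT, coreX2, coreZ,
      Pi.sub_apply, Pi.add_apply, Pi.smul_apply, Pi.zero_apply, smul_eq_mul]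
    and_intros <;> intros <;> push_cast <;> field_simp <;> ring

/-- The action of the quotient algebra on functionals on the span of the PBW monomials. -/
def rep (hq : q ≠ 0) : RingQuot (rel k q) →ₐ[k] Module.End k (Idx → k) :=
  RingQuot.liftAlgHom k ⟨freeRep q, fun _ _ h => by rw [freeRep_rels hq h.1, h.2, map_zero]⟩

theorem freeRep_t_pow (l : ℕ) (f : Idx → k) (a : Fin 2) (n : ℕ) :
    (freeRep q (t k q) ^ l) f ⟨a, n, 0, 0, 0, 0⟩ = f ⟨a, n + l, 0, 0, 0, 0⟩ := by
  induction l generalizing n with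
  | zero => rfl
  | succ l ih =>
    rw [pow_succ', Module.End.mul_apply, freeRep_t]
    simp [actT, coreT, ih, add_assoc, add_comm 1]

theorem freeRep_z_pow (l : ℕ) (f : Idx → k) (a b : Fin 2) (n m : ℕ) :
    (freeRep q (z k q) ^ l) f ⟨a, n, b, m, 0, 0⟩ = f ⟨a, n, b, m + l, 0, 0⟩ := by
  induction l generalizing m with
  | zero => rfl
  | succ l ih =>
    rw [pow_succ', Module.End.mul_apply, freeRep_z]
    simp [actZ, coreZ, ih, add_assoc, add_comm 1]

theorem freeRep_u_pow (f : Idx → k) (a : Fin 2) :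
    (freeRep q (u k) ^ (a : ℕ)) f ⟨0, 0, 0, 0, 0, 0⟩ = f ⟨a, 0, 0, 0, 0, 0⟩ := by
  fin_cases a <;> simp [freeRep_u, actU, coreU]

theorem freeRep_x2_pow (f : Idx → k) (a b : Fin 2) (n : ℕ) :
    (freeRep q (x2 k) ^ (b : ℕ)) f ⟨a, n, 0, 0, 0, 0⟩ = f ⟨a, n, b, 0, 0, 0⟩ := by
  fin_cases b <;> simp [freeRep_x2, actX2, coreX2]

theorem freeRep_y_pow (f : Idx → k) (a b c : Fin 2) (n m : ℕ) :
    (freeRep q (y k) ^ (c : ℕ)) f ⟨a, n, b, m, 0, 0⟩ = f ⟨a, n, b, m, c, 0⟩ := by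
  fin_cases c <;> simp [freeRep_y, actY]

theorem freeRep_x1_pow (f : Idx → k) (a b c d : Fin 2) (n m : ℕ) :
    (freeRep q (x1 k) ^ (d : ℕ)) f ⟨a, n, b, m, c, 0⟩ = f ⟨a, n, b, m, c, d⟩ := by
  fin_cases d <;> simp [freeRep_x1, actX1]

theorem rep_mon (hq : q ≠ 0) (i : Idx) (f : Idx → k) :
    rep hq (mon k q i) f ⟨0, 0, 0, 0, 0, 0⟩ = f i := by
  simp only [rep, mon, RingQuot.liftAlgHom_mkAlgHom_apply, map_mul, map_pow,
    Module.End.mul_apply, freeRep_u_pow, freeRep_t_pow, freeRep_x2_pow, freeRep_z_pow,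
    freeRep_y_pow, freeRep_x1_pow, zero_add]

theorem linearIndependent_mon (hq : q ≠ 0) : LinearIndependent k (mon k q) := by
  classical
  rw [linearIndependent_iff]
  intro l hl
  ext j
  have h := congrArg (fun b => rep hq b (Pi.single j 1) ⟨0, 0, 0, 0, 0, 0⟩) hl
  simpa [Finsupp.linearCombination_apply, Finsupp.sum, map_sum, LinearMap.sum_apply,
    Finset.sum_apply, rep_mon, Pi.single_apply] using h

end Representation

section Spanning

variable {k} {A : Type*} [Ring A] [Algebra k A]

/-- The straightening rules for elements `x, y, w, u, z, t` of a `k`-algebra playing the roles of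
`x1, y, x2, u, z, t`. -/
structure Straightens (x y w u z t : A) : Prop where
  x_sq : x * x = 0
  y_sq : y * y = 0
  w_sq : w * w = 0
  u_sq : u * u = 0
  t_u : t * u = -q • (u * t) + t * w
  w_u : w * u = -(u * w)
  z_u : z * u = -q • (u * z + w * z)
  w_t : w * t = (-q)⁻¹ • (t * w)
  z_t : z * t = t * z + z * z
  z_w : z * w = -q • (w * z)
  y_u : y * u = t + q • (u * y) + q • (w * y)
  y_w : y * w = z + q • (w * y)
  y_z : y * z = -q • (z * y)
  x_u : x * u = q • (u * x) + q • (w * x) + z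
  x_w : x * w = q • (w * x)
  x_y : x * y = -(y * x)

namespace Straightens

variable {q} {x y w u z t : A}

theorem w_pow_mul_u (h : Straightens q x y w u z t) (b : ℕ) :
    w ^ b * u = (-1 : k) ^ b • (u * w ^ b) := by
  induction b with
  | zero => simp
  | succ b ih =>
    rw [pow_succ, mul_assoc, h.w_u, mul_neg, ← mul_assoc, ih, smul_mul_assoc, mul_assoc,
      pow_succ, mul_smul, neg_one_smul, smul_neg]

theorem w_pow_mul_t (h : Straightens q x y w u z t) (b : ℕ) :
    w ^ b * t = (-q)⁻¹ ^ b • (t * w ^ b) := by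
  induction b with
  | zero => simp
  | succ b ih =>
    rw [pow_succ, mul_assoc, h.w_t, mul_smul_comm, ← mul_assoc, ih, smul_mul_assoc, smul_smul,
      mul_assoc, ← pow_succ']

theorem z_pow_mul_w (h : Straightens q x y w u z t) (m : ℕ) :
    z ^ m * w = (-q) ^ m • (w * z ^ m) := by
  induction m with
  | zero => simp
  | succ m ih =>
    rw [pow_succ, mul_assoc, h.z_w, mul_smul_comm, ← mul_assoc, ih, smul_mul_assoc, smul_smul,
      mul_assoc, ← pow_succ']

theorem z_pow_mul_t (h : Straightens q x y w u z t) (m : ℕ) :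
    z ^ m * t = t * z ^ m + (m : k) • z ^ (m + 1) := by
  induction m with
  | zero => simp
  | succ m ih =>
    rw [pow_succ, mul_assoc, h.z_t, mul_add, ← mul_assoc, ih, add_mul, smul_mul_assoc, mul_assoc,
      ← mul_assoc (z ^ m), ← pow_succ, ← pow_succ]
    push_cast
    module

theorem z_pow_mul_u (h : Straightens q x y w u z t) (m : ℕ) :
    z ^ m * u = (-q) ^ m • (u * z ^ m + (m : k) • (w * z ^ m)) := by
  induction m with
  | zero => simp
  | succ m ih =>
    rw [pow_succ, mul_assoc, h.z_u, mul_smul_comm, mul_add, ← mul_assoc, ← mul_assoc, ih,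
      h.z_pow_mul_w]
    simp only [add_mul, smul_mul_assoc, mul_assoc, ← pow_succ]
    push_cast
    module

theorem t_pow_mul_u (hq : q ≠ 0) (h : Straightens q x y w u z t) (n : ℕ) :
    t ^ n * u = (-q) ^ n • (u * t ^ n) + (n : k) • (t ^ n * w) := by
  induction n with
  | zero => simp
  | succ n ih =>
    rw [pow_succ, mul_assoc, h.t_u, mul_add, mul_smul_comm, ← mul_assoc, ih, add_mul,
      smul_mul_assoc, smul_mul_assoc, mul_assoc _ w t, h.w_t, mul_smul_comm, smul_add, smul_smul,
      smul_smul, smul_smul, mul_assoc u, ← mul_assoc _ t w, ← pow_succ]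
    have : -q * n * (-q)⁻¹ = n := by field_simp
    rw [this, ← pow_succ']
    push_cast
    module

theorem of_relations (hq : q ≠ 0) (hz : z = y * w - q • (w * y))
    (ht : t = y * u - q • ((u + w) * y)) (xx : x * x = 0) (yy : y * y = 0) (ww : w * w = 0)
    (uu : u * u = 0) (xy : x * y + y * x = 0) (wu : w * u + u * w = 0)
    (wx : w * x - q⁻¹ • (x * w) = 0) (wz : w * z + q⁻¹ • (z * w) = 0)
    (xu : x * u - q • ((u + w) * x) - z = 0) (tw : t * w + q • (w * t) = 0)
    (tu : t * u + q • (u * t) + q • (w * t) = 0) (tz : t * z - z * t + z * z = 0) :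
    Straightens q x y w u z t where
  x_sq := xx
  y_sq := yy
  w_sq := ww
  u_sq := uu
  t_u := by linear_combination (norm := module) tu - tw
  w_u := eq_neg_of_add_eq_zero_left wu
  z_u := by
    linear_combination (norm :=
      (simp only [mul_add, add_mul, mul_sub, sub_mul, mul_smul_comm, smul_mul_assoc, mul_assoc,
        mul_zero, zero_mul]; module))
      hz * u + q • (u * hz) + q • (w * hz) + y * wu + ht * w + q • (w * ht) -
        (q ^ 2) • (wu * y) - (2 * q ^ 2) • (ww * y) - tw
  w_t := by
    rw [eq_neg_of_add_eq_zero_left tw, inv_neg, smul_neg, neg_smul, neg_neg, inv_smul_smul₀ hq]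
  z_t := by linear_combination (norm := module) -tz
  z_w := by
    rw [eq_neg_of_add_eq_zero_left wz, smul_neg, neg_smul, neg_neg, smul_inv_smul₀ hq]
  y_u := by
    linear_combination (norm := (simp only [add_mul]; module)) -ht
  y_w := by linear_combination (norm := module) -hz
  y_z := by
    linear_combination (norm :=
      (simp only [mul_sub, sub_mul, mul_smul_comm, smul_mul_assoc, mul_assoc,
        mul_zero, zero_mul]; module))
      y * hz + q • (hz * y) + yy * w - (q ^ 2) • (w * yy)
  x_u := by
    linear_combination (norm := (simp only [add_mul]; module)) xu
  x_w := by rw [sub_eq_zero.mp wx, smul_inv_smul₀ hq]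
  x_y := eq_neg_of_add_eq_zero_left xy

/-- The span of the monomials in `u, t, w, z`. -/
def core (k : Type*) [Field k] {A : Type*} [Ring A] [Algebra k A] (w u z t : A) : Submodule k A :=
  Submodule.span k {v | ∃ a n b m : ℕ, u ^ a * t ^ n * w ^ b * z ^ m = v}

theorem mem_core (w u z t : A) (a n b m : ℕ) : u ^ a * t ^ n * w ^ b * z ^ m ∈ core k w u z t :=
  Submodule.subset_span ⟨a, n, b, m, rfl⟩

theorem core_mul_mem {g v : A} (hv : v ∈ core k w u z t)
    (hg : ∀ a n b m : ℕ, u ^ a * t ^ n * w ^ b * z ^ m * g ∈ core k w u z t) :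
    v * g ∈ core k w u z t := by
  induction hv using Submodule.span_induction with
  | mem v hv => obtain ⟨a, n, b, m, rfl⟩ := hv; exact hg a n b m
  | zero => simp
  | add v v' _ _ hv hv' => rw [add_mul]; exact add_mem hv hv'
  | smul r v _ hv => rw [smul_mul_assoc]; exact Submodule.smul_mem _ r hv

theorem core_mul_z {v : A} (hv : v ∈ core k w u z t) : v * z ∈ core k w u z t :=
  core_mul_mem hv fun a n b m => by
    rw [mul_assoc, ← pow_succ]
    exact mem_core w u z t _ _ _ _

theorem core_mul_w (h : Straightens q x y w u z t) {v : A} (hv : v ∈ core k w u z t) :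
    v * w ∈ core k w u z t :=
  core_mul_mem hv fun a n b m => by
    rw [mul_assoc, h.z_pow_mul_w, mul_smul_comm, ← mul_assoc, mul_assoc _ _ w, ← pow_succ]
    exact Submodule.smul_mem _ _ (mem_core w u z t _ _ _ _)

theorem core_mul_t (h : Straightens q x y w u z t) {v : A} (hv : v ∈ core k w u z t) :
    v * t ∈ core k w u z t :=
  core_mul_mem hv fun a n b m => by
    have : u ^ a * t ^ n * w ^ b * z ^ m * t =
        (-q)⁻¹ ^ b • (u ^ a * t ^ (n + 1) * w ^ b * z ^ m) +
          (m : k) • (u ^ a * t ^ n * w ^ b * z ^ (m + 1)) := by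
      rw [mul_assoc, h.z_pow_mul_t, mul_add, mul_smul_comm, ← mul_assoc, mul_assoc _ _ t,
        h.w_pow_mul_t, mul_smul_comm, smul_mul_assoc, ← mul_assoc, mul_assoc _ _ t, ← pow_succ]
    rw [this]
    exact add_mem (Submodule.smul_mem _ _ (mem_core w u z t _ _ _ _))
      (Submodule.smul_mem _ _ (mem_core w u z t _ _ _ _))

theorem core_mul_u (hq : q ≠ 0) (h : Straightens q x y w u z t) {v : A}
    (hv : v ∈ core k w u z t) : v * u ∈ core k w u z t :=
  core_mul_mem hv fun a n b m => by
    have : u ^ a * t ^ n * w ^ b * z ^ m * u =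
        ((-q) ^ m * (-1) ^ b * (-q) ^ n) • (u ^ (a + 1) * t ^ n * w ^ b * z ^ m) +
          ((-q) ^ m * ((-1) ^ b * n + m)) • (u ^ a * t ^ n * w ^ (b + 1) * z ^ m) := by
      rw [mul_assoc, h.z_pow_mul_u]
      calc _ = (-q) ^ m • (u ^ a * (t ^ n * (w ^ b * u)) * z ^ m +
            (m : k) • (u ^ a * t ^ n * w ^ (b + 1) * z ^ m)) := by
              simp only [mul_add, mul_smul_comm, mul_assoc, pow_succ]
        _ = (-q) ^ m • ((-1 : k) ^ b • (u ^ a * (t ^ n * u) * w ^ b * z ^ m) +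
            (m : k) • (u ^ a * t ^ n * w ^ (b + 1) * z ^ m)) := by
              rw [h.w_pow_mul_u]
              simp only [mul_smul_comm, smul_mul_assoc, mul_assoc]
        _ = _ := by
              rw [h.t_pow_mul_u hq]
              simp only [mul_add, add_mul, mul_smul_comm, smul_mul_assoc, mul_assoc, pow_succ,
                pow_succ' w]
              module
    rw [this]
    exact add_mem (Submodule.smul_mem _ _ (mem_core w u z t _ _ _ _))
      (Submodule.smul_mem _ _ (mem_core w u z t _ _ _ _))

/-- The PBW monomials in `x, y, w, u, z, t`. -/
def pbw (x y w u z t : A) (i : Idx) : A :=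
  u ^ (i.m1 : ℕ) * t ^ i.m2 * w ^ (i.m3 : ℕ) * z ^ i.m4 * y ^ (i.m5 : ℕ) * x ^ (i.m6 : ℕ)

theorem core_mul_mem_span (h : Straightens q x y w u z t) {v : A} (hv : v ∈ core k w u z t)
    (c d : Fin 2) :
    v * y ^ (c : ℕ) * x ^ (d : ℕ) ∈ Submodule.span k (Set.range (pbw x y w u z t)) := by
  induction hv using Submodule.span_induction with
  | mem v hv =>
    obtain ⟨a, n, b, m, rfl⟩ := hv
    by_cases ha : a < 2
    · by_cases hb : b < 2
      · exact Submodule.subset_span ⟨⟨⟨a, ha⟩, n, ⟨b, hb⟩, m, c, d⟩, rfl⟩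
      · have : w ^ b = 0 := pow_eq_zero_of_le (not_lt.mp hb) (by rw [pow_two, h.w_sq])
        simp [this]
    · have : u ^ a = 0 := pow_eq_zero_of_le (not_lt.mp ha) (by rw [pow_two, h.u_sq])
      simp [this]
  | zero => simp
  | add v v' _ _ hv hv' => rw [add_mul, add_mul]; exact add_mem hv hv'
  | smul r v _ hv => rw [smul_mul_assoc, smul_mul_assoc]; exact Submodule.smul_mem _ r hv

theorem span_mul_mem {g s : A} (hs : s ∈ Submodule.span k (Set.range (pbw x y w u z t)))
    (hg : ∀ v ∈ core k w u z t, ∀ c d : Fin 2,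
      v * y ^ (c : ℕ) * x ^ (d : ℕ) * g ∈ Submodule.span k (Set.range (pbw x y w u z t))) :
    s * g ∈ Submodule.span k (Set.range (pbw x y w u z t)) := by
  induction hs using Submodule.span_induction with
  | mem s hs => obtain ⟨i, rfl⟩ := hs; exact hg _ (mem_core w u z t _ _ _ _) i.m5 i.m6
  | zero => simp
  | add s s' _ _ hs hs' => rw [add_mul]; exact add_mem hs hs'
  | smul r s _ hs => rw [smul_mul_assoc]; exact Submodule.smul_mem _ r hs

theorem span_mul_x (h : Straightens q x y w u z t) {s : A}
    (hs : s ∈ Submodule.span k (Set.range (pbw x y w u z t))) :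
    s * x ∈ Submodule.span k (Set.range (pbw x y w u z t)) := by
  refine span_mul_mem hs fun v hv c d => ?_
  fin_cases d
  · simpa using h.core_mul_mem_span hv c 1
  · simp [mul_assoc, h.x_sq]

theorem span_mul_y (h : Straightens q x y w u z t) {s : A}
    (hs : s ∈ Submodule.span k (Set.range (pbw x y w u z t))) :
    s * y ∈ Submodule.span k (Set.range (pbw x y w u z t)) := by
  refine span_mul_mem hs fun v hv c d => ?_
  fin_cases c <;> fin_cases d
  · simpa using h.core_mul_mem_span hv 1 0
  · simpa [mul_assoc, h.x_y] using h.core_mul_mem_span hv 1 1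
  · simp [mul_assoc, h.y_sq]
  · simp [mul_assoc, h.x_y, ← mul_assoc y y, h.y_sq]

theorem span_mul_w (h : Straightens q x y w u z t) {s : A}
    (hs : s ∈ Submodule.span k (Set.range (pbw x y w u z t))) :
    s * w ∈ Submodule.span k (Set.range (pbw x y w u z t)) := by
  refine span_mul_mem hs fun v hv => ?_
  have hw := h.core_mul_mem_span (h.core_mul_w hv)
  have hz := h.core_mul_mem_span (core_mul_z hv)
  simp only [Fin.forall_fin_two, Fin.val_zero, Fin.val_one, pow_zero, pow_one, mul_one, one_mul,
    mul_assoc] at hw hz ⊢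
  refine ⟨⟨hw.1.1, ?_⟩, ?_, ?_⟩
  · simpa only [h.x_w, mul_smul_comm] using Submodule.smul_mem _ q hw.1.2
  · simpa only [h.y_w, mul_add, mul_smul_comm] using
      add_mem hz.1.1 (Submodule.smul_mem _ q hw.2.1)
  · have : v * (y * (x * w)) = q • (v * (z * x)) + (q * q) • (v * (w * (y * x))) := by
      rw [h.x_w, mul_smul_comm, ← mul_assoc y, h.y_w]
      simp only [mul_add, add_mul, mul_smul_comm, smul_mul_assoc, mul_assoc]
      module
    rw [this]
    exact add_mem (Submodule.smul_mem _ _ hz.1.2) (Submodule.smul_mem _ _ hw.2.2)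

theorem span_mul_u (hq : q ≠ 0) (h : Straightens q x y w u z t) {s : A}
    (hs : s ∈ Submodule.span k (Set.range (pbw x y w u z t))) :
    s * u ∈ Submodule.span k (Set.range (pbw x y w u z t)) := by
  refine span_mul_mem hs fun v hv => ?_
  have hw := h.core_mul_mem_span (h.core_mul_w hv)
  have hz := h.core_mul_mem_span (core_mul_z hv)
  have ht := h.core_mul_mem_span (h.core_mul_t hv)
  have hu := h.core_mul_mem_span (h.core_mul_u hq hv)
  simp only [Fin.forall_fin_two, Fin.val_zero, Fin.val_one, pow_zero, pow_one, mul_one, one_mul,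
    mul_assoc] at hw hz ht hu ⊢
  refine ⟨⟨hu.1.1, ?_⟩, ?_, ?_⟩
  · simpa only [h.x_u, mul_add, mul_smul_comm] using
      add_mem (add_mem (Submodule.smul_mem _ q hu.1.2) (Submodule.smul_mem _ q hw.1.2)) hz.1.1
  · simpa only [h.y_u, mul_add, mul_smul_comm] using
      add_mem (add_mem ht.1.1 (Submodule.smul_mem _ q hu.2.1)) (Submodule.smul_mem _ q hw.2.1)
  · have : v * (y * (x * u)) = q • (v * (t * x)) + (q * q) • (v * (u * (y * x))) +
        (2 * q * q) • (v * (w * (y * x))) + q • (v * (z * x)) - q • (v * (z * y)) := by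
      rw [h.x_u]
      simp only [mul_add, mul_smul_comm, ← mul_assoc y, h.y_u, h.y_w, h.y_z]
      simp only [mul_add, add_mul, mul_smul_comm, smul_mul_assoc, mul_assoc]
      module
    rw [this]
    exact sub_mem (add_mem (add_mem (add_mem (Submodule.smul_mem _ _ ht.1.2)
      (Submodule.smul_mem _ _ hu.2.2)) (Submodule.smul_mem _ _ hw.2.2))
      (Submodule.smul_mem _ _ hz.1.2)) (Submodule.smul_mem _ _ hz.2.1)

end Straightens

variable {q}

theorem straightens_mkAlgHom (hq : q ≠ 0) :
    Straightens q (RingQuot.mkAlgHom k (rel k q) (x1 k)) (RingQuot.mkAlgHom k (rel k q) (y k))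
      (RingQuot.mkAlgHom k (rel k q) (x2 k)) (RingQuot.mkAlgHom k (rel k q) (u k))
      (RingQuot.mkAlgHom k (rel k q) (z k q)) (RingQuot.mkAlgHom k (rel k q) (t k q)) := by
  have hrel : ∀ a ∈ rels k q, RingQuot.mkAlgHom k (rel k q) a = 0 := fun a ha => by
    rw [RingQuot.mkAlgHom_rel k (show rel k q a 0 from ⟨ha, rfl⟩), map_zero]
  have hz : RingQuot.mkAlgHom k (rel k q) (z k q) =
      RingQuot.mkAlgHom k (rel k q) (y k) * RingQuot.mkAlgHom k (rel k q) (x2 k) -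
        q • (RingQuot.mkAlgHom k (rel k q) (x2 k) * RingQuot.mkAlgHom k (rel k q) (y k)) := by
    rw [z, map_sub, map_smul, map_mul, map_mul]
  have ht : RingQuot.mkAlgHom k (rel k q) (t k q) =
      RingQuot.mkAlgHom k (rel k q) (y k) * RingQuot.mkAlgHom k (rel k q) (u k) -
        q • ((RingQuot.mkAlgHom k (rel k q) (u k) + RingQuot.mkAlgHom k (rel k q) (x2 k)) *
          RingQuot.mkAlgHom k (rel k q) (y k)) := by
    rw [t, map_sub, map_smul, map_mul, map_mul, map_add]
  simp only [rels, Set.forall_mem_insert, Set.mem_singleton_iff, forall_eq, map_sub, map_add,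
    map_smul, map_mul, pow_two] at hrel
  obtain ⟨xx, yy, ww, uu, xy, wu, wx, wz, -, xu, tw, tu, tz⟩ := hrel
  exact .of_relations hq hz ht xx yy ww uu xy wu wx wz xu tw tu tz

theorem span_mon (hq : q ≠ 0) : Submodule.span k (Set.range (mon k q)) = ⊤ := by
  have h := straightens_mkAlgHom hq
  have hmon : mon k q = Straightens.pbw (RingQuot.mkAlgHom k (rel k q) (x1 k))
      (RingQuot.mkAlgHom k (rel k q) (y k)) (RingQuot.mkAlgHom k (rel k q) (x2 k))
      (RingQuot.mkAlgHom k (rel k q) (u k)) (RingQuot.mkAlgHom k (rel k q) (z k q))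
      (RingQuot.mkAlgHom k (rel k q) (t k q)) := by
    ext i
    simp [mon, Straightens.pbw]
  have hmul : ∀ a s, s ∈ Submodule.span k (Set.range (mon k q)) →
      s * RingQuot.mkAlgHom k (rel k q) a ∈ Submodule.span k (Set.range (mon k q)) := by
    intro a
    induction a using FreeAlgebra.induction with
    | grade0 r =>
      intro s hs
      rw [AlgHom.commutes, ← Algebra.commutes, ← Algebra.smul_def]
      exact Submodule.smul_mem _ r hs
    | grade1 i =>
      rw [hmon]
      intro s hs
      fin_cases i
      exacts [h.span_mul_x hs, h.span_mul_y hs, h.span_mul_w hs, h.span_mul_u hq hs]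
    | mul a b ha hb =>
      intro s hs
      rw [map_mul, ← mul_assoc]
      exact hb _ (ha _ hs)
    | add a b ha hb =>
      intro s hs
      rw [map_add, mul_add]
      exact add_mem (ha _ hs) (hb _ hs)
  refine eq_top_iff.mpr fun b _ => ?_
  obtain ⟨a, rfl⟩ := RingQuot.mkAlgHom_surjective k (rel k q) b
  rw [← one_mul (RingQuot.mkAlgHom k (rel k q) a)]
  exact hmul a 1 (Submodule.subset_span ⟨⟨0, 0, 0, 0, 0, 0⟩, by simp [mon]⟩)

end Spanning

theorem statement13 [IsAlgClosed k] [CharZero k] (hq : q ≠ 0) :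
    LinearIndependent k (mon k q) ∧
      Submodule.span k (Set.range (mon k q)) = ⊤ := by
  exact ⟨linearIndependent_mon hq, span_mon hq⟩

end Stmt13
end
end

section
/- Let A be any associative k-algebra containing elements x1,y,x2,u that satisfy: x1² = y² = x2² = u² = 0; x1·y = −y·x1; x2·u = −u·x2; x2·x1 = q⁻¹·x1·x2; x2·z = −q⁻¹·z·x2; x1·s = −q·s·x1; and x1·u − q·(u+x2)·x1 = z. Then the following identities hold in A: x1·t = −q·(t+z)·x1 and y·z = −q·z·y. If in addition t·x2 = −q·x2·t holds in A, then also z·u = −q·u·z − q·x2·z. -/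
/- Statement 14: the relations (6.10) and subsequent commutation relation from the proof
   of Theorem 6.2 of the paper, for the presented algebra 𝔅(𝔖_{2,0}(q)). -/

theorem statement14 {k A : Type*} [Field k] [IsAlgClosed k] [CharZero k]
    [Ring A] [Algebra k A]
    (q : k) (hq : q ≠ 0) (x1 y x2 u z s t : A)
    (hz : z = y * x2 - q • (x2 * y))
    (hs : s = u * x1 - q⁻¹ • (x1 * u))
    (ht : t = y * u - q • ((u + x2) * y))
    (r1 : x1 ^ 2 = 0) (r2 : y ^ 2 = 0) (r3 : x2 ^ 2 = 0) (r4 : u ^ 2 = 0)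
    (r5 : x1 * y = -(y * x1))
    (r6 : x2 * u = -(u * x2))
    (r7 : x2 * x1 = q⁻¹ • (x1 * x2))
    (r8 : x2 * z = -(q⁻¹ • (z * x2)))
    (r9 : x1 * s = -(q • (s * x1)))
    (r10 : x1 * u - q • ((u + x2) * x1) = z) :
    (x1 * t = -(q • ((t + z) * x1))) ∧
    (y * z = -(q • (z * y))) ∧
    (t * x2 = -(q • (x2 * t)) →
      z * u = -(q • (u * z)) - q • (x2 * z)) := by
  have r7' : x1 * x2 = q • (x2 * x1) := by rw [r7, smul_inv_smul₀ hq]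
  rw [pow_two] at r2 r3
  subst ht hz
  refine ⟨?_, ?_, fun h => ?_⟩
  · linear_combination (norm := (
      simp only [mul_add, add_mul, mul_sub, sub_mul, mul_neg, neg_mul, smul_mul_assoc,
        mul_smul_comm, mul_assoc, smul_add, smul_sub, mul_zero, zero_mul]; module))
      r5 * u - y * r10 - q • (r10 * y) - (q ^ 2) • ((u + x2) * r5) - q • (r7' * y)
        - (q ^ 2) • (x2 * r5) - r2 * x2 + (q ^ 2) • (x2 * r2)
  · linear_combination (norm := (simp only [mul_sub, sub_mul, smul_mul_assoc,
      mul_smul_comm, mul_assoc, smul_sub, mul_zero, zero_mul]; module))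
      r2 * x2 - (q ^ 2) • (x2 * r2)
  · linear_combination (norm := (
      simp only [mul_add, add_mul, mul_sub, sub_mul, mul_neg, neg_mul, smul_mul_assoc,
        mul_smul_comm, mul_assoc, smul_add, smul_sub, zero_mul]; module))
      y * r6 - h - (q ^ 2) • (r6 * y) - (2 * q ^ 2) • (r3 * y)
end
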